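/- Let μ, ν ∈ P_2(ℝ^d), where ℝ^d carries the standard Euclidean norm, and let η* ∈ P_2(ℝ^d) be dominated by ν in convex order. Then the following are equivalent: (1) W_2(μ,η*) = V_2(μ,ν), i.e. η* solves inf_{η ≤_c ν} W_2(μ,η); (2) there is a convex function φ : ℝ^d → ℝ whose gradient ∇φ : ℝ^d → ℝ^d is 1-Lipschitz, such that η* = ∇φ#μ and (id, ∇φ)#μ is the unique optimizer of inf_{π ∈ Π(μ,ν)} ∫_{ℝ^d} | x − ∫_{ℝ^d} y π_x(dy) |² μ(dx). -/

import Mathlib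

open MeasureTheory ProbabilityTheory ENNReal NNReal

noncomputable section

/-- `ℝ^d` with the standard Euclidean norm. -/
abbrev Euc (d : ℕ) : Type := EuclideanSpace ℝ (Fin d)

variable {d : ℕ}

/-- Finite second moment. -/
def Mem2 (p : ProbabilityMeasure (Euc d)) : Prop :=
  Integrable (fun x => ‖x‖ ^ 2) (p : Measure (Euc d))

/-- The convex order `μ ≤_c ν`: `∫ φ dμ ≤ ∫ φ dν` for every convex function of at most
linear growth. -/
def ConvexOrder (p q : ProbabilityMeasure (Euc d)) : Prop :=
  ∀ φ : Euc d → ℝ, ConvexOn ℝ Set.univ φ →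
    (∃ K : ℝ, ∀ x, |φ x| ≤ K * (1 + ‖x‖)) →
    ∫ x, φ x ∂(p : Measure (Euc d)) ≤ ∫ x, φ x ∂(q : Measure (Euc d))

/-- `π` is a coupling of `μ` and `ν`. -/
def IsCoupling (μ ν : ProbabilityMeasure (Euc d))
    (π : ProbabilityMeasure (Euc d × Euc d)) : Prop :=
  (π : Measure (Euc d × Euc d)).map Prod.fst = (μ : Measure (Euc d)) ∧
    (π : Measure (Euc d × Euc d)).map Prod.snd = (ν : Measure (Euc d))

/-- The squared quadratic Wasserstein distance. -/
noncomputable def W2sq (μ ν : ProbabilityMeasure (Euc d)) : ℝ≥0∞ :=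
  ⨅ (π : ProbabilityMeasure (Euc d × Euc d)) (_ : IsCoupling μ ν π),
    ∫⁻ z, ENNReal.ofReal (‖z.1 - z.2‖ ^ 2) ∂(π : Measure (Euc d × Euc d))

/-- The value `V₂(μ,ν)² = inf_{η ≤_c ν} W₂(μ,η)²`. -/
noncomputable def V2sq (μ ν : ProbabilityMeasure (Euc d)) : ℝ≥0∞ :=
  ⨅ (η : ProbabilityMeasure (Euc d)) (_ : ConvexOrder η ν), W2sq μ η

/-- The barycenter of a measure. -/
noncomputable def bary (p : Measure (Euc d)) : Euc d := ∫ y, y ∂p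

/-- The barycentric weak transport cost `∫ ‖x - ∫ y π_x(dy)‖² μ(dx)` of a coupling `π`. -/
noncomputable def weakCost2 (μ : ProbabilityMeasure (Euc d))
    (π : ProbabilityMeasure (Euc d × Euc d)) : ℝ≥0∞ :=
  ∫⁻ x, ENNReal.ofReal
      (‖x - bary ((π : Measure (Euc d × Euc d)).condKernel x)‖ ^ 2) ∂(μ : Measure (Euc d))

/-- The value of the barycentric weak transport problem over `Π(μ,ν)`. -/
noncomputable def weakVal2 (μ ν : ProbabilityMeasure (Euc d)) : ℝ≥0∞ :=
  ⨅ (π : ProbabilityMeasure (Euc d × Euc d)) (_ : IsCoupling μ ν π), weakCost2 μ π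

section BarycentricProjection

open Filter Topology
open scoped RealInnerProductSpace

/-- A convex function of at most linear growth is Lipschitz. -/
lemma ConvexOn.lipschitzWith_of_linear_growth {E : Type*} [NormedAddCommGroup E]
    [NormedSpace ℝ E] {φ : E → ℝ} (hφ : ConvexOn ℝ Set.univ φ) {K : ℝ}
    (hK : ∀ x, |φ x| ≤ K * (1 + ‖x‖)) : LipschitzWith K.toNNReal φ := by
  have hK0 : 0 ≤ K := by simpa using (abs_nonneg _).trans (hK 0)
  refine LipschitzWith.of_le_add_mul _ fun x y => ?_
  rw [Real.coe_toNNReal _ hK0, dist_eq_norm, ← sub_le_iff_le_add']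
  have hlim : Tendsto (fun t : ℝ => K * ‖x - y‖ + (K * (1 + ‖y‖) - φ y) * t⁻¹) atTop
      (𝓝 (K * ‖x - y‖ + (K * (1 + ‖y‖) - φ y) * 0)) :=
    (tendsto_inv_atTop_zero.const_mul _).const_add _
  rw [mul_zero, add_zero] at hlim
  refine ge_of_tendsto hlim ?_
  filter_upwards [eventually_ge_atTop 1] with t ht
  have ht0 : 0 < t := by linarith
  have hconv := hφ.2 (Set.mem_univ y) (Set.mem_univ (y + t • (x - y)))
    (sub_nonneg.2 (inv_le_one_of_one_le₀ ht)) (inv_nonneg.2 ht0.le) (by ring)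
  have hx : (1 - t⁻¹) • y + t⁻¹ • (y + t • (x - y)) = x := by
    rw [smul_add, smul_smul, inv_mul_cancel₀ ht0.ne']
    module
  rw [hx] at hconv
  have hfar : φ (y + t • (x - y)) ≤ K * (1 + ‖y‖ + t * ‖x - y‖) := by
    refine (le_abs_self _).trans ((hK _).trans ?_)
    have := norm_add_le y (t • (x - y))
    rw [norm_smul, Real.norm_of_nonneg ht0.le] at this
    exact mul_le_mul_of_nonneg_left (by linarith) hK0
  have hmul := mul_le_mul_of_nonneg_left hfar (inv_nonneg.2 ht0.le)
  have hexp : t⁻¹ * (K * (1 + ‖y‖ + t * ‖x - y‖)) = t⁻¹ * (K * (1 + ‖y‖)) + K * ‖x - y‖ := by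
    field_simp
  simp only [smul_eq_mul] at hconv
  nlinarith

section Potential

variable {E : Type*} [NormedAddCommGroup E] [InnerProductSpace ℝ E]

lemma convexOn_of_subgradient {φ : E → ℝ} {P : E → E}
    (h : ∀ x y, φ x + ⟪P x, y - x⟫ ≤ φ y) : ConvexOn ℝ Set.univ φ := by
  refine ⟨convex_univ, fun x _ y _ a b ha hb hab => ?_⟩
  set z := a • x + b • y
  have hzero : a * ⟪P z, x - z⟫ + b * ⟪P z, y - z⟫ = 0 := by
    rw [← real_inner_smul_right, ← real_inner_smul_right, ← inner_add_right]
    have : a • (x - z) + b • (y - z) = 0 := by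
      calc a • (x - z) + b • (y - z) = z - (a + b) • z := by simp only [z]; module
        _ = 0 := by rw [hab, one_smul, sub_self]
    rw [this, inner_zero_right]
  have hx := mul_le_mul_of_nonneg_left (h z x) ha
  have hy := mul_le_mul_of_nonneg_left (h z y) hb
  have : φ z = a * φ z + b * φ z := by rw [← add_mul, hab, one_mul]
  simp only [smul_eq_mul]
  linarith

lemma hasGradientAt_of_subgradient [CompleteSpace E] {φ : E → ℝ} {P : E → E}
    (h : ∀ x y, φ x + ⟪P x, y - x⟫ ≤ φ y) (hP : LipschitzWith 1 P) (x : E) :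
    HasGradientAt φ (P x) x := by
  rw [hasGradientAt_iff_isLittleO]
  refine Asymptotics.IsBigO.trans_isLittleO (g := fun y => ‖y - x‖ ^ 2) ?_ ?_
  · refine Asymptotics.IsBigO.of_bound 1 (Eventually.of_forall fun y => ?_)
    have h1 := h x y
    have h2 := h y x
    have h3 : ⟪P y - P x, y - x⟫ ≤ ‖y - x‖ ^ 2 := by
      refine (real_inner_le_norm _ _).trans ?_
      have := hP.norm_sub_le y x
      rw [NNReal.coe_one, one_mul] at this
      nlinarith [norm_nonneg (y - x)]
    rw [inner_sub_left] at h3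
    rw [← neg_sub y x, inner_neg_right] at h2
    rw [one_mul, Real.norm_of_nonneg (by linarith), Real.norm_of_nonneg (by positivity)]
    linarith
  · exact Asymptotics.isLittleO_pow_sub_sub x one_lt_two

/-- A closed convex epigraph with an affine minorant has a proximal map, characterized by its
variational inequality. -/
lemma exists_proximal_point [ProperSpace E] {C : Set (E × ℝ)} (hC : IsClosed C)
    (hconv : Convex ℝ C) (hne : C.Nonempty) {a : ℝ} {u : E}
    (hlow : ∀ z ∈ C, a + ⟪u, z.1⟫ ≤ z.2) (x : E) :
    ∃ p ∈ C, ∀ z ∈ C, p.2 + ⟪x - p.1, z.1 - p.1⟫ ≤ z.2 := by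
  obtain ⟨z₀, hz₀⟩ := hne
  set f : E × ℝ → ℝ := fun z => ‖x - z.1‖ ^ 2 / 2 + z.2 with hf
  have hfc : Continuous f := by fun_prop
  set D := C ∩ {z | f z ≤ f z₀} with hD
  have hDclosed : IsClosed D := hC.inter (isClosed_le hfc continuous_const)
  set M := f z₀ - a - ⟪u, x⟫ with hM
  have hbound : ∀ z ∈ D, ‖x - z.1‖ ≤ 2 * ‖u‖ + |M| + 2 ∧
      a + ⟪u, z.1⟫ ≤ z.2 ∧ z.2 ≤ f z₀ := by
    rintro z ⟨hzC, hz⟩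
    have h1 := hlow z hzC
    have h2 : ⟪u, x - z.1⟫ ≤ ‖u‖ * ‖x - z.1‖ := real_inner_le_norm _ _
    rw [inner_sub_right] at h2
    have hz' : ‖x - z.1‖ ^ 2 / 2 + z.2 ≤ f z₀ := hz
    have h4 := le_abs_self M
    have h5 : ‖x - z.1‖ ^ 2 / 2 ≤ |M| + ‖u‖ * ‖x - z.1‖ := by linarith
    refine ⟨?_, h1, by nlinarith [sq_nonneg ‖x - z.1‖]⟩
    by_contra! hlt
    nlinarith [norm_nonneg u, norm_nonneg (x - z.1), abs_nonneg M]
  have hDbdd : Bornology.IsBounded D := by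
    rw [Metric.isBounded_iff_subset_closedBall (x, f z₀)]
    set R := 2 * ‖u‖ + |M| + 2
    refine ⟨R + (|f z₀ - a - ⟪u, x⟫| + ‖u‖ * R), fun z hz => ?_⟩
    obtain ⟨h1, h2, h3⟩ := hbound z hz
    have hR : 0 ≤ R := (norm_nonneg _).trans h1
    have h4 : ⟪u, x - z.1⟫ ≤ ‖u‖ * ‖x - z.1‖ := real_inner_le_norm _ _
    have h5 : ‖u‖ * ‖x - z.1‖ ≤ ‖u‖ * R := by gcongr
    rw [inner_sub_right] at h4
    rw [Metric.mem_closedBall, Prod.dist_eq, max_le_iff]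
    constructor
    · rw [dist_comm, dist_eq_norm]
      have : 0 ≤ ‖u‖ * R := by positivity
      linarith [abs_nonneg (f z₀ - a - ⟪u, x⟫)]
    · rw [dist_comm, Real.dist_eq, abs_of_nonneg (by simpa using h3)]
      have := le_abs_self (f z₀ - a - ⟪u, x⟫)
      simp only
      linarith
  have hDcpt : IsCompact D := Metric.isCompact_of_isClosed_isBounded hDclosed hDbdd
  obtain ⟨p, hpD, hp⟩ := hDcpt.exists_isMinOn ⟨z₀, hz₀, le_refl (f z₀)⟩ hfc.continuousOn
  have hmin : ∀ z ∈ C, f p ≤ f z := by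
    intro z hz
    by_cases h : f z ≤ f z₀
    · exact hp ⟨hz, h⟩
    · exact hpD.2.trans (not_le.1 h).le
  refine ⟨p, hpD.1, fun z hz => ?_⟩
  have hkey : ∀ t ∈ Set.Ioc (0 : ℝ) 1,
      p.2 + ⟪x - p.1, z.1 - p.1⟫ - z.2 ≤ t * (‖z.1 - p.1‖ ^ 2 / 2) := by
    rintro t ⟨ht0, ht1⟩
    have hmem : p + t • (z - p) ∈ C := hconv.add_smul_sub_mem hpD.1 hz ⟨ht0.le, ht1⟩
    have h := hmin _ hmem
    simp only [hf, Prod.fst_add, Prod.snd_add, Prod.smul_fst, Prod.smul_snd, Prod.fst_sub,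
      Prod.snd_sub, smul_eq_mul] at h
    have hexp : ‖x - (p.1 + t • (z.1 - p.1))‖ ^ 2 = ‖x - p.1‖ ^ 2
        - 2 * (t * ⟪x - p.1, z.1 - p.1⟫) + t ^ 2 * ‖z.1 - p.1‖ ^ 2 := by
      rw [← sub_sub, norm_sub_sq_real, real_inner_smul_right, norm_smul, mul_pow,
        Real.norm_eq_abs, sq_abs]
    rw [hexp] at h
    refine le_of_mul_le_mul_left ?_ ht0
    nlinarith
  have hlim : Tendsto (fun t : ℝ => t * (‖z.1 - p.1‖ ^ 2 / 2)) (𝓝[>] 0)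
      (𝓝 (0 * (‖z.1 - p.1‖ ^ 2 / 2))) :=
    (tendsto_id.mono_left nhdsWithin_le_nhds).mul_const _
  rw [zero_mul] at hlim
  have := ge_of_tendsto hlim (eventually_of_mem (Ioc_mem_nhdsGT zero_lt_one) hkey)
  linarith

/-- The Moreau envelope construction: the proximal map of a closed convex epigraph is the
`1`-Lipschitz gradient of a convex function. -/
lemma exists_gradient_of_epigraph [ProperSpace E] [CompleteSpace E] {C : Set (E × ℝ)}
    (hC : IsClosed C)
    (hconv : Convex ℝ C) (hne : C.Nonempty) {a : ℝ} {u : E}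
    (hlow : ∀ z ∈ C, a + ⟪u, z.1⟫ ≤ z.2) :
    ∃ φ : E → ℝ, ConvexOn ℝ Set.univ φ ∧ Differentiable ℝ φ ∧ LipschitzWith 1 (gradient φ) ∧
      ∀ x, ∀ p ∈ C, (∀ z ∈ C, p.2 + ⟪x - p.1, z.1 - p.1⟫ ≤ z.2) → gradient φ x = p.1 := by
  choose p hpC hp using exists_proximal_point hC hconv hne hlow
  have hmono : ∀ x y : E, ∀ q ∈ C, (∀ z ∈ C, q.2 + ⟪y - q.1, z.1 - q.1⟫ ≤ z.2) →
      ‖(p x).1 - q.1‖ ^ 2 ≤ ⟪x - y, (p x).1 - q.1⟫ := by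
    intro x y q hqC hq
    have h1 := hp x q hqC
    have h2 := hq (p x) (hpC x)
    have h3 : ⟪x - (p x).1, q.1 - (p x).1⟫ = -⟪x - (p x).1, (p x).1 - q.1⟫ := by
      rw [← inner_neg_right, neg_sub]
    have h4 : ⟪x - y, (p x).1 - q.1⟫ = ⟪x - (p x).1, (p x).1 - q.1⟫
        - ⟪y - q.1, (p x).1 - q.1⟫ + ‖(p x).1 - q.1‖ ^ 2 := by
      rw [← real_inner_self_eq_norm_sq, ← inner_sub_left, ← inner_add_left]
      congr 1
      abel
    linarith
  have hlip : LipschitzWith 1 fun x => (p x).1 := by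
    refine LipschitzWith.of_dist_le_mul fun x y => ?_
    rw [NNReal.coe_one, one_mul, dist_eq_norm, dist_eq_norm]
    have h1 := hmono x y (p y) (hpC y) (hp y)
    have h2 := real_inner_le_norm (x - y) ((p x).1 - (p y).1)
    by_contra! hlt
    nlinarith [norm_nonneg (x - y)]
  have hsub : ∀ x y : E, (⟪x, (p x).1⟫ - ‖(p x).1‖ ^ 2 / 2 - (p x).2) + ⟪(p x).1, y - x⟫ ≤
      ⟪y, (p y).1⟫ - ‖(p y).1‖ ^ 2 / 2 - (p y).2 := by
    intro x y
    have h1 := hp y (p x) (hpC x)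
    have h2 := norm_sub_sq_real (p x).1 (p y).1
    have h3 := sq_nonneg ‖(p x).1 - (p y).1‖
    rw [inner_sub_right, inner_sub_left, inner_sub_left, real_inner_self_eq_norm_sq,
      real_inner_comm] at h1
    rw [inner_sub_right, real_inner_comm x, real_inner_comm y]
    rw [real_inner_comm y] at h1
    rw [real_inner_comm] at h2
    nlinarith
  have hgrad := fun x => hasGradientAt_of_subgradient hsub hlip x
  have heq : gradient (fun x => ⟪x, (p x).1⟫ - ‖(p x).1‖ ^ 2 / 2 - (p x).2) =
      fun x => (p x).1 := funext fun x => (hgrad x).gradient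
  refine ⟨_, convexOn_of_subgradient hsub, fun x => (hgrad x).differentiableAt,
    heq ▸ hlip, fun x q hqC hq => ?_⟩
  rw [heq]
  have h := hmono x x q hqC hq
  rw [sub_self, inner_zero_left] at h
  exact sub_eq_zero.1 (norm_eq_zero.1 (pow_eq_zero_iff two_ne_zero |>.1
    (le_antisymm h (sq_nonneg _))))

/-- Values accumulated along the chains of Rockafellar's construction: a pair `(x, y)` stands for
the subgradient `x - y` at the point `y`. -/
inductive ChainValue (S : Set (E × E)) (p₀ : E × E) : E × E → ℝ → Prop
  | base : ChainValue S p₀ p₀ 0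
  | step {p q : E × E} {r : ℝ} : ChainValue S p₀ p r → q ∈ S →
      ChainValue S p₀ q (r + ⟪p.1 - p.2, q.2 - p.2⟫)

/-- Rockafellar's theorem for firmly cyclically monotone sets. -/
lemma exists_gradient_of_cyclic [ProperSpace E] [CompleteSpace E] {S : Set (E × E)} {p₀ : E × E}
    (hp₀ : p₀ ∈ S) (hcyc : ∀ r, ChainValue S p₀ p₀ r → r ≤ 0) :
    ∃ φ : E → ℝ, ConvexOn ℝ Set.univ φ ∧ Differentiable ℝ φ ∧ LipschitzWith 1 (gradient φ) ∧
      ∀ p ∈ S, gradient φ p.1 = p.2 := by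
  set C : Set (E × ℝ) :=
    {z | ∀ p r, ChainValue S p₀ p r → r + ⟪p.1 - p.2, z.1 - p.2⟫ ≤ z.2} with hCdef
  have hC : IsClosed C := by
    simp only [hCdef, Set.ofPred_forall]
    refine isClosed_iInter fun p => isClosed_iInter fun r => isClosed_iInter fun _ => ?_
    exact isClosed_le (by fun_prop) continuous_snd
  have hconv : Convex ℝ C := by
    intro z hz w hw a b ha hb hab p r hr
    have h1 := mul_le_mul_of_nonneg_left (hz p r hr) ha
    have h2 := mul_le_mul_of_nonneg_left (hw p r hr) hb
    have h3 : (a • z + b • w).1 - p.2 = a • (z.1 - p.2) + b • (w.1 - p.2) := by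
      have : p.2 = (a + b) • p.2 := by rw [hab, one_smul]
      rw [Prod.fst_add, Prod.smul_fst, Prod.smul_fst]
      nth_rw 1 [this]
      module
    rw [h3, inner_add_right, real_inner_smul_right, real_inner_smul_right]
    have h4 : r = a * r + b * r := by rw [← add_mul, hab, one_mul]
    simp only [Prod.snd_add, Prod.smul_snd, smul_eq_mul]
    linarith
  have hbdd : ∀ q ∈ S, ∀ r, ChainValue S p₀ q r → r ≤ -⟪q.1 - q.2, p₀.2 - q.2⟫ := by
    intro q _ r hr
    linarith [hcyc _ (hr.step hp₀)]
  have hreach : ∀ q ∈ S, {r | ChainValue S p₀ q r}.Nonempty := fun q hq =>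
    ⟨_, ChainValue.base.step hq⟩
  set τ : E × E → ℝ := fun q => sSup {r | ChainValue S p₀ q r}
  have hτC : ∀ q ∈ S, (q.2, τ q) ∈ C := fun q hq p r hr =>
    le_csSup ⟨_, fun r hr => hbdd q hq r hr⟩ (hr.step hq)
  have hτ : ∀ q ∈ S, ∀ z ∈ C, τ q + ⟪q.1 - q.2, z.1 - q.2⟫ ≤ z.2 := by
    intro q hq z hz
    rw [← le_sub_iff_add_le]
    exact csSup_le (hreach q hq) fun r hr => le_sub_iff_add_le.2 (hz q r hr)
  obtain ⟨φ, h1, h2, h3, h4⟩ := exists_gradient_of_epigraph hC hconv ⟨_, hτC _ hp₀⟩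
    (a := -⟪p₀.1 - p₀.2, p₀.2⟫) (u := p₀.1 - p₀.2) fun z hz => by
      have := hz _ _ ChainValue.base
      rw [inner_sub_right] at this
      linarith
  exact ⟨φ, h1, h2, h3, fun q hq => h4 q.1 (q.2, τ q) (hτC q hq) (hτ q hq)⟩

/-- Chain values are the sums along finite chains. -/
lemma ChainValue.exists_chain {S : Set (E × E)} {p₀ : E × E} (hp₀ : p₀ ∈ S) {p : E × E} {r : ℝ}
    (h : ChainValue S p₀ p r) : ∃ (n : ℕ) (f : ℕ → E × E), (∀ i, f i ∈ S) ∧ f 0 = p₀ ∧ f n = p ∧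
      r = ∑ i ∈ Finset.range n, ⟪(f i).1 - (f i).2, (f (i + 1)).2 - (f i).2⟫ := by
  induction h with
  | base => exact ⟨0, fun _ => p₀, fun _ => hp₀, rfl, rfl, by simp⟩
  | @step p q r _ hq ih =>
    obtain ⟨n, f, hS, h0, hn, hr⟩ := ih
    refine ⟨n + 1, fun i => if i ≤ n then f i else q, fun i => ?_, by simpa using h0, by simp, ?_⟩
    · dsimp only
      split_ifs
      exacts [hS i, hq]
    · rw [Finset.sum_range_succ]
      have : ∀ i ∈ Finset.range n, i ≤ n ∧ i + 1 ≤ n := fun i hi => by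
        have := Finset.mem_range.1 hi
        omega
      rw [hr]
      congr 1
      · refine Finset.sum_congr rfl fun i hi => ?_
        dsimp only
        rw [if_pos (this i hi).1, if_pos (this i hi).2]
      · simp [hn]

end Potential

/-- The convex functions of at most linear growth, which test the convex order. -/
def ConvexTest (φ : Euc d → ℝ) : Prop :=
  ConvexOn ℝ Set.univ φ ∧ ∃ K : ℝ, ∀ x, |φ x| ≤ K * (1 + ‖x‖)

lemma ConvexTest.exists_lipschitzWith {φ : Euc d → ℝ} (hφ : ConvexTest φ) :
    ∃ K : ℝ≥0, LipschitzWith K φ :=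
  let ⟨hc, _, hK⟩ := hφ
  ⟨_, hc.lipschitzWith_of_linear_growth hK⟩

lemma ConvexTest.continuous {φ : Euc d → ℝ} (hφ : ConvexTest φ) : Continuous φ :=
  let ⟨_, hK⟩ := hφ.exists_lipschitzWith
  hK.continuous

lemma ConvexTest.integrable_comp {α : Type*} [MeasurableSpace α] {m : Measure α}
    [IsFiniteMeasure m] {φ : Euc d → ℝ} (hφ : ConvexTest φ) {f : α → Euc d}
    (hf : Integrable f m) : Integrable (fun x => φ (f x)) m := by
  obtain ⟨-, K, hK⟩ := id hφ
  refine Integrable.mono' (((integrable_const (1 : ℝ)).add hf.norm).const_mul K)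
    (hφ.continuous.comp_aestronglyMeasurable hf.1) (Eventually.of_forall fun x => ?_)
  simpa using hK (f x)

lemma ConvexOrder.integral_le {p q : ProbabilityMeasure (Euc d)} (h : ConvexOrder p q)
    {φ : Euc d → ℝ} (hφ : ConvexTest φ) :
    ∫ x, φ x ∂(p : Measure (Euc d)) ≤ ∫ x, φ x ∂(q : Measure (Euc d)) :=
  h φ hφ.1 hφ.2

lemma Mem2.memLp {p : ProbabilityMeasure (Euc d)} (hp : Mem2 p) :
    MemLp id 2 (p : Measure (Euc d)) :=
  (memLp_two_iff_integrable_sq_norm aestronglyMeasurable_id).2 hp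

/-- The square integrable maps pushing `μ` below `ν` in the convex order. -/
def admissibleMaps (μ ν : ProbabilityMeasure (Euc d)) :
    Set (Lp (Euc d) 2 (μ : Measure (Euc d))) :=
  {T | ∀ φ : Euc d → ℝ, ConvexTest φ →
    ∫ x, φ (T x) ∂(μ : Measure (Euc d)) ≤ ∫ y, φ y ∂(ν : Measure (Euc d))}

section Admissible

variable {μ ν : ProbabilityMeasure (Euc d)}

lemma integrable_coe_Lp (T : Lp (Euc d) 2 (μ : Measure (Euc d))) :
    Integrable T (μ : Measure (Euc d)) := (Lp.memLp T).integrable one_le_two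

lemma toLp_mem_admissibleMaps {f : Euc d → Euc d} (hf : MemLp f 2 (μ : Measure (Euc d)))
    (h : ∀ φ : Euc d → ℝ, ConvexTest φ →
      ∫ x, φ (f x) ∂(μ : Measure (Euc d)) ≤ ∫ y, φ y ∂(ν : Measure (Euc d))) :
    hf.toLp f ∈ admissibleMaps μ ν := by
  intro φ hφ
  refine le_of_eq_of_le (integral_congr_ae ?_) (h φ hφ)
  filter_upwards [hf.coeFn_toLp] with x hx
  rw [hx]

lemma convex_admissibleMaps : Convex ℝ (admissibleMaps μ ν) := by
  intro T hT S hS a b ha hb hab φ hφ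
  have hTi := hφ.integrable_comp (integrable_coe_Lp T)
  have hSi := hφ.integrable_comp (integrable_coe_Lp S)
  have h1 := mul_le_mul_of_nonneg_left (hT φ hφ) ha
  have h2 := mul_le_mul_of_nonneg_left (hS φ hφ) hb
  have h3 : ∫ x, φ ((a • T + b • S : Lp (Euc d) 2 (μ : Measure (Euc d))) x)
      ∂(μ : Measure (Euc d)) ≤ ∫ x, (a * φ (T x) + b * φ (S x)) ∂(μ : Measure (Euc d)) := by
    refine integral_mono_ae (hφ.integrable_comp (integrable_coe_Lp _))
      ((hTi.const_mul a).add (hSi.const_mul b)) ?_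
    filter_upwards [Lp.coeFn_add (a • T) (b • S), Lp.coeFn_smul a T, Lp.coeFn_smul b S]
      with x hx h1 h2
    rw [hx, Pi.add_apply, h1, h2]
    exact hφ.1.2 (Set.mem_univ _) (Set.mem_univ _) ha hb hab
  rw [integral_add (hTi.const_mul a) (hSi.const_mul b), integral_const_mul,
    integral_const_mul] at h3
  have h4 : ∀ c : ℝ, c = a * c + b * c := fun c => by rw [← add_mul, hab, one_mul]
  rw [h4 (∫ y, φ y ∂(ν : Measure (Euc d)))]
  linarith

lemma continuous_integral_comp_Lp {φ : Euc d → ℝ} (hφ : ConvexTest φ) :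
    Continuous fun T : Lp (Euc d) 2 (μ : Measure (Euc d)) =>
      ∫ x, φ (T x) ∂(μ : Measure (Euc d)) := by
  obtain ⟨K, hK⟩ := hφ.exists_lipschitzWith
  refine LipschitzWith.continuous (K := K) (LipschitzWith.of_dist_le_mul fun T S => ?_)
  have hTi := hφ.integrable_comp (integrable_coe_Lp T)
  have hSi := hφ.integrable_comp (integrable_coe_Lp S)
  have hd : MemLp (fun x => T x - S x) 2 (μ : Measure (Euc d)) := (Lp.memLp T).sub (Lp.memLp S)
  rw [Real.dist_eq, ← integral_sub hTi hSi]
  calc |∫ x, (φ (T x) - φ (S x)) ∂(μ : Measure (Euc d))|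
      ≤ ∫ x, |φ (T x) - φ (S x)| ∂(μ : Measure (Euc d)) := abs_integral_le_integral_abs
    _ ≤ ∫ x, K * ‖T x - S x‖ ∂(μ : Measure (Euc d)) := by
      refine integral_mono (hTi.sub hSi).abs ((hd.integrable one_le_two).norm.const_mul _)
        fun x => ?_
      simpa [Real.dist_eq, dist_eq_norm] using hK.dist_le_mul (T x) (S x)
    _ = K * ∫ x, ‖T x - S x‖ ∂(μ : Measure (Euc d)) := integral_const_mul _ _
    _ ≤ K * dist T S := by
      gcongr
      rw [dist_eq_norm, Lp.norm_def, integral_norm_eq_lintegral_enorm hd.1,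
        ← eLpNorm_one_eq_lintegral_enorm]
      refine ENNReal.toReal_mono (Lp.eLpNorm_ne_top _) ?_
      rw [eLpNorm_congr_ae (Lp.coeFn_sub T S)]
      exact eLpNorm_le_eLpNorm_of_exponent_le one_le_two hd.1

lemma isClosed_admissibleMaps : IsClosed (admissibleMaps μ ν) := by
  simp only [admissibleMaps, Set.ofPred_forall]
  exact isClosed_iInter fun φ => isClosed_iInter fun hφ =>
    isClosed_le (continuous_integral_comp_Lp hφ) continuous_const

lemma admissibleMaps_nonempty (hν : Mem2 ν) : (admissibleMaps μ ν).Nonempty := by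
  refine ⟨_, toLp_mem_admissibleMaps (memLp_const (∫ y, y ∂(ν : Measure (Euc d))))
    fun φ hφ => ?_⟩
  have hi : Integrable (fun y => y) (ν : Measure (Euc d)) := hν.memLp.integrable one_le_two
  rw [integral_const, probReal_univ, one_smul]
  exact hφ.1.map_integral_le hφ.continuous.continuousOn isClosed_univ (by simp) hi
    (hφ.integrable_comp hi)

lemma exists_projection_admissibleMaps (hν : Mem2 ν) (f : Lp (Euc d) 2 (μ : Measure (Euc d))) :
    ∃ T ∈ admissibleMaps μ ν, ∀ S ∈ admissibleMaps μ ν, ⟪f - T, S - T⟫ ≤ 0 := by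
  obtain ⟨T, hT, h⟩ := exists_norm_eq_iInf_of_complete_convex (admissibleMaps_nonempty hν)
    isClosed_admissibleMaps.isComplete (convex_admissibleMaps (μ := μ) (ν := ν)) f
  exact ⟨T, hT, (norm_eq_iInf_iff_real_inner_le_zero convex_admissibleMaps hT).1 h⟩

end Admissible

section Barycenter

/-- The conditional barycenter `x ↦ ∫ y π_x(dy)` of a measure on the product. -/
def baryMap (π : ProbabilityMeasure (Euc d × Euc d)) (x : Euc d) : Euc d :=
  bary ((π : Measure (Euc d × Euc d)).condKernel x)

variable {μ ν η : ProbabilityMeasure (Euc d)} {π : ProbabilityMeasure (Euc d × Euc d)}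

lemma IsCoupling.fst_eq (h : IsCoupling μ η π) :
    (π : Measure (Euc d × Euc d)).fst = (μ : Measure (Euc d)) := h.1

lemma IsCoupling.integrable_snd (h : IsCoupling μ η π) {F : Type*} [NormedAddCommGroup F]
    {f : Euc d → F}
    (hf : Integrable f (η : Measure (Euc d))) :
    Integrable (fun z => f z.2) (π : Measure (Euc d × Euc d)) := by
  rw [← h.2] at hf
  exact hf.comp_measurable measurable_snd

lemma IsCoupling.memLp_fst (h : IsCoupling μ η π) {F : Type*} [NormedAddCommGroup F]
    {f : Euc d → F} (hf : MemLp f 2 (μ : Measure (Euc d))) :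
    MemLp (fun z => f z.1) 2 (π : Measure (Euc d × Euc d)) := by
  rw [← h.1] at hf
  exact hf.comp_of_map measurable_fst.aemeasurable

lemma IsCoupling.memLp_snd (h : IsCoupling μ η π) {F : Type*} [NormedAddCommGroup F]
    {f : Euc d → F} (hf : MemLp f 2 (η : Measure (Euc d))) :
    MemLp (fun z => f z.2) 2 (π : Measure (Euc d × Euc d)) := by
  rw [← h.2] at hf
  exact hf.comp_of_map measurable_snd.aemeasurable

lemma IsCoupling.integral_fst (h : IsCoupling μ η π) {F : Type*} [NormedAddCommGroup F]
    [NormedSpace ℝ F] {f : Euc d → F} (hf : AEStronglyMeasurable f (μ : Measure (Euc d))) :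
    ∫ z, f z.1 ∂(π : Measure (Euc d × Euc d)) = ∫ x, f x ∂(μ : Measure (Euc d)) := by
  rw [← h.1] at hf ⊢
  exact (integral_map measurable_fst.aemeasurable hf).symm

lemma IsCoupling.integral_snd (h : IsCoupling μ η π) {F : Type*} [NormedAddCommGroup F]
    [NormedSpace ℝ F] {f : Euc d → F} (hf : AEStronglyMeasurable f (η : Measure (Euc d))) :
    ∫ z, f z.2 ∂(π : Measure (Euc d × Euc d)) = ∫ y, f y ∂(η : Measure (Euc d)) := by
  rw [← h.2] at hf ⊢
  exact (integral_map measurable_snd.aemeasurable hf).symm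

lemma IsCoupling.ae_integrable_condKernel (h : IsCoupling μ η π) {F : Type*}
    [NormedAddCommGroup F] {f : Euc d × Euc d → F}
    (hf : Integrable f (π : Measure (Euc d × Euc d))) :
    ∀ᵐ x ∂(μ : Measure (Euc d)),
      Integrable (fun y => f (x, y)) ((π : Measure (Euc d × Euc d)).condKernel x) := by
  rw [← h.fst_eq]
  exact hf.condKernel_ae

lemma IsCoupling.map_baryMap_le (h : IsCoupling μ η π)
    (hη : Integrable (fun y => y) (η : Measure (Euc d))) {φ : Euc d → ℝ}
    (hφ : ConvexOn ℝ Set.univ φ) (hφc : Continuous φ)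
    (hφi : Integrable φ (η : Measure (Euc d))) :
    ∀ᵐ x ∂(μ : Measure (Euc d)),
      φ (baryMap π x) ≤ ∫ y, φ y ∂((π : Measure (Euc d × Euc d)).condKernel x) := by
  filter_upwards [h.ae_integrable_condKernel (h.integrable_snd hη),
    h.ae_integrable_condKernel (h.integrable_snd hφi)] with x hx hx'
  exact hφ.map_integral_le hφc.continuousOn isClosed_univ (by simp) hx hx'

lemma IsCoupling.integrable_integral_condKernel (h : IsCoupling μ η π) {F : Type*}
    [NormedAddCommGroup F] [NormedSpace ℝ F] {f : Euc d → F}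
    (hf : Integrable f (η : Measure (Euc d))) :
    Integrable (fun x => ∫ y, f y ∂((π : Measure (Euc d × Euc d)).condKernel x))
      (μ : Measure (Euc d)) := by
  have := (h.integrable_snd hf).integral_condKernel
  rwa [h.fst_eq] at this

lemma IsCoupling.integral_integral_condKernel (h : IsCoupling μ η π) {F : Type*}
    [NormedAddCommGroup F] [NormedSpace ℝ F] {f : Euc d × Euc d → F}
    (hf : Integrable f (π : Measure (Euc d × Euc d))) :
    ∫ x, ∫ y, f (x, y) ∂((π : Measure (Euc d × Euc d)).condKernel x) ∂(μ : Measure (Euc d)) =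
      ∫ z, f z ∂(π : Measure (Euc d × Euc d)) := by
  rw [← h.fst_eq]
  exact Measure.integral_condKernel hf

lemma IsCoupling.memLp_baryMap (h : IsCoupling μ η π) (hη : Mem2 η) :
    MemLp (baryMap π) 2 (μ : Measure (Euc d)) := by
  have hi : Integrable (fun y => y) (η : Measure (Euc d)) := hη.memLp.integrable one_le_two
  have hmeas : AEStronglyMeasurable (baryMap π) (μ : Measure (Euc d)) :=
    (h.integrable_integral_condKernel hi).1
  refine (memLp_two_iff_integrable_sq_norm hmeas).2 ?_
  refine (h.integrable_integral_condKernel hη).mono' (hmeas.norm.pow 2) ?_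
  have hconv : ConvexOn ℝ Set.univ fun x : Euc d => ‖x‖ ^ 2 :=
    convexOn_univ_norm.pow (fun _ _ => norm_nonneg _) 2
  filter_upwards [h.map_baryMap_le hi hconv (by fun_prop) hη] with x hx
  rwa [Real.norm_of_nonneg (by positivity)]

lemma IsCoupling.baryMap_mem_admissibleMaps (h : IsCoupling μ η π) (hη : Mem2 η)
    (hord : ConvexOrder η ν) : (h.memLp_baryMap hη).toLp (baryMap π) ∈ admissibleMaps μ ν := by
  have hi : Integrable (fun y => y) (η : Measure (Euc d)) := hη.memLp.integrable one_le_two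
  refine toLp_mem_admissibleMaps _ fun φ hφ => ?_
  have hφi := hφ.integrable_comp hi
  calc ∫ x, φ (baryMap π x) ∂(μ : Measure (Euc d))
      ≤ ∫ x, ∫ y, φ y ∂((π : Measure (Euc d × Euc d)).condKernel x) ∂(μ : Measure (Euc d)) :=
        integral_mono_ae (hφ.integrable_comp ((h.memLp_baryMap hη).integrable one_le_two))
          (h.integrable_integral_condKernel hφi) (h.map_baryMap_le hi hφ.1 hφ.continuous hφi)
    _ = ∫ z, φ z.2 ∂(π : Measure (Euc d × Euc d)) :=
        h.integral_integral_condKernel (h.integrable_snd hφi)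
    _ = ∫ y, φ y ∂(η : Measure (Euc d)) :=
        h.integral_snd hφ.continuous.aestronglyMeasurable
    _ ≤ ∫ y, φ y ∂(ν : Measure (Euc d)) := hord.integral_le hφ

lemma MeasureTheory.MemLp.integrable_real_inner {α : Type*} [MeasurableSpace α] {m : Measure α}
    {f g : α → Euc d} (hf : MemLp f 2 m) (hg : MemLp g 2 m) :
    Integrable (fun x => ⟪f x, g x⟫) m := by
  refine Integrable.mono' (hf.integrable_norm_pow two_ne_zero |>.add
    (hg.integrable_norm_pow two_ne_zero)) (hf.1.inner hg.1) (Eventually.of_forall fun x => ?_)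
  have h1 := norm_inner_le_norm (𝕜 := ℝ) (f x) (g x)
  simp only [Pi.add_apply]
  nlinarith [sq_nonneg (‖f x‖ - ‖g x‖), sq_nonneg ‖f x‖, sq_nonneg ‖g x‖]

lemma IsCoupling.integral_inner_snd (h : IsCoupling μ η π) (hη : Mem2 η) {g : Euc d → Euc d}
    (hg : MemLp g 2 (μ : Measure (Euc d))) :
    ∫ z, ⟪g z.1, z.2⟫ ∂(π : Measure (Euc d × Euc d)) =
      ∫ x, ⟪g x, baryMap π x⟫ ∂(μ : Measure (Euc d)) := by
  have hi : Integrable (fun y => y) (η : Measure (Euc d)) := hη.memLp.integrable one_le_two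
  rw [← h.integral_integral_condKernel (f := fun z => ⟪g z.1, z.2⟫)
    ((h.memLp_fst hg).integrable_real_inner (h.memLp_snd hη.memLp))]
  refine integral_congr_ae ?_
  filter_upwards [h.ae_integrable_condKernel (h.integrable_snd hi)] with x hx
  exact integral_inner hx (g x)

end Barycenter

section Projection

variable {μ ν η : ProbabilityMeasure (Euc d)} {π : ProbabilityMeasure (Euc d × Euc d)}

/-- `T` is the metric projection of the identity on the set of admissible maps. -/
structure IsBaryProjection (μ ν : ProbabilityMeasure (Euc d)) (T : Euc d → Euc d) : Prop where
  measurable : Measurable T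
  memLp : MemLp T 2 (μ : Measure (Euc d))
  integral_comp_le : ∀ φ : Euc d → ℝ, ConvexTest φ →
    ∫ x, φ (T x) ∂(μ : Measure (Euc d)) ≤ ∫ y, φ y ∂(ν : Measure (Euc d))
  integral_inner_le : ∀ f : Euc d → Euc d, MemLp f 2 (μ : Measure (Euc d)) →
    (∀ φ : Euc d → ℝ, ConvexTest φ →
      ∫ x, φ (f x) ∂(μ : Measure (Euc d)) ≤ ∫ y, φ y ∂(ν : Measure (Euc d))) →
    ∫ x, ⟪x - T x, f x - T x⟫ ∂(μ : Measure (Euc d)) ≤ 0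

lemma exists_isBaryProjection (hμ : Mem2 μ) (hν : Mem2 ν) :
    ∃ T, IsBaryProjection μ ν T := by
  obtain ⟨T, hT, h⟩ := exists_projection_admissibleMaps hν (hμ.memLp.toLp id)
  refine ⟨T, (Lp.stronglyMeasurable T).measurable, Lp.memLp T, hT, fun f hf hfν => ?_⟩
  refine le_of_eq_of_le ?_ (h _ (toLp_mem_admissibleMaps hf hfν))
  rw [L2.inner_def]
  refine integral_congr_ae ?_
  filter_upwards [Lp.coeFn_sub (hμ.memLp.toLp id) T, Lp.coeFn_sub (hf.toLp f) T,
    hμ.memLp.coeFn_toLp, hf.coeFn_toLp] with x h1 h2 h3 h4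
  rw [h1, h2, Pi.sub_apply, Pi.sub_apply, h3, h4, id]

namespace IsBaryProjection

variable {T : Euc d → Euc d}

lemma memLp_id_sub (hT : IsBaryProjection μ ν T) (hμ : Mem2 μ) :
    MemLp (fun x => x - T x) 2 (μ : Measure (Euc d)) := hμ.memLp.sub hT.memLp

lemma integral_add_integral_le (hT : IsBaryProjection μ ν T) (hμ : Mem2 μ)
    {f : Euc d → Euc d} (hf : MemLp f 2 (μ : Measure (Euc d)))
    (hfν : ∀ φ : Euc d → ℝ, ConvexTest φ →
      ∫ x, φ (f x) ∂(μ : Measure (Euc d)) ≤ ∫ y, φ y ∂(ν : Measure (Euc d))) :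
    ∫ x, ‖x - T x‖ ^ 2 ∂(μ : Measure (Euc d)) + ∫ x, ‖f x - T x‖ ^ 2 ∂(μ : Measure (Euc d)) ≤
      ∫ x, ‖x - f x‖ ^ 2 ∂(μ : Measure (Euc d)) := by
  have h1 := hT.memLp_id_sub hμ
  have h2 : MemLp (fun x => f x - T x) 2 (μ : Measure (Euc d)) := hf.sub hT.memLp
  have h3 := h1.integrable_norm_pow two_ne_zero
  have h4 := h2.integrable_norm_pow two_ne_zero
  have h5 := (h1.integrable_real_inner h2).const_mul 2
  have h6 : ∀ x, ‖x - f x‖ ^ 2 =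
      ‖x - T x‖ ^ 2 - 2 * ⟪x - T x, f x - T x⟫ + ‖f x - T x‖ ^ 2 := fun x => by
    rw [← norm_sub_sq_real, sub_sub_sub_cancel_right]
  have h7 : Integrable (fun x => ‖x - T x‖ ^ 2 - 2 * ⟪x - T x, f x - T x⟫)
      (μ : Measure (Euc d)) := h3.sub h5
  simp_rw [h6]
  rw [integral_add h7 h4, integral_sub h3 h5, integral_const_mul]
  linarith [hT.integral_inner_le f hf hfν]

lemma integral_coupling_le (hT : IsBaryProjection μ ν T) (hμ : Mem2 μ) (hη : Mem2 η)
    (hord : ConvexOrder η ν) (h : IsCoupling μ η π) :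
    ∫ x, ‖x - T x‖ ^ 2 ∂(μ : Measure (Euc d)) +
        ∫ z, ‖z.2 - T z.1‖ ^ 2 ∂(π : Measure (Euc d × Euc d)) ≤
      ∫ z, ‖z.1 - z.2‖ ^ 2 ∂(π : Measure (Euc d × Euc d)) := by
  have h1 := hT.memLp_id_sub hμ
  have h1' : MemLp (fun z => z.1 - T z.1) 2 (π : Measure (Euc d × Euc d)) := h.memLp_fst h1
  have h2 : MemLp (fun z => z.2 - T z.1) 2 (π : Measure (Euc d × Euc d)) :=
    (h.memLp_snd hη.memLp).sub (h.memLp_fst hT.memLp)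
  have h3 := h1'.integrable_norm_pow two_ne_zero
  have h4 := h2.integrable_norm_pow two_ne_zero
  have h5 := (h1'.integrable_real_inner h2).const_mul 2
  have h6 : ∀ z : Euc d × Euc d, ‖z.1 - z.2‖ ^ 2 =
      ‖z.1 - T z.1‖ ^ 2 - 2 * ⟪z.1 - T z.1, z.2 - T z.1⟫ + ‖z.2 - T z.1‖ ^ 2 := fun z => by
    rw [← norm_sub_sq_real, sub_sub_sub_cancel_right]
  have hbm := h.baryMap_mem_admissibleMaps hη hord
  have h7 : ∫ z, ⟪z.1 - T z.1, z.2 - T z.1⟫ ∂(π : Measure (Euc d × Euc d)) ≤ 0 := by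
    have h8 := hT.integral_inner_le (baryMap π) (h.memLp_baryMap hη) fun φ hφ => by
      refine le_of_eq_of_le (integral_congr_ae ?_) (hbm φ hφ)
      filter_upwards [(h.memLp_baryMap hη).coeFn_toLp] with x hx
      rw [hx]
    refine le_of_eq_of_le ?_ h8
    simp_rw [inner_sub_right]
    rw [integral_sub ?_ ?_, integral_sub ?_ ?_, h.integral_inner_snd hη h1,
      
      h.integral_fst (f := fun x => ⟪x - T x, T x⟫) (h1.1.inner hT.memLp.1)]
    · exact h1.integrable_real_inner (h.memLp_baryMap hη)
    · exact h1.integrable_real_inner hT.memLp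
    · exact h1'.integrable_real_inner (h.memLp_snd hη.memLp)
    · exact h1'.integrable_real_inner (h.memLp_fst hT.memLp)
  have h9 := h.integral_fst (h1.1.norm.pow 2)
  have h10 : Integrable (fun z : Euc d × Euc d =>
      ‖z.1 - T z.1‖ ^ 2 - 2 * ⟪z.1 - T z.1, z.2 - T z.1⟫)
      (π : Measure (Euc d × Euc d)) := h3.sub h5
  simp_rw [h6]
  rw [integral_add h10 h4, integral_sub h3 h5, integral_const_mul]
  simp only [Pi.pow_apply] at h9
  linarith

end IsBaryProjection

lemma lintegral_ofReal_norm_sq {α : Type*} [MeasurableSpace α] {m : Measure α}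
    {f : α → Euc d} (hf : MemLp f 2 m) :
    ∫⁻ x, ENNReal.ofReal (‖f x‖ ^ 2) ∂m = ENNReal.ofReal (∫ x, ‖f x‖ ^ 2 ∂m) :=
  (ofReal_integral_eq_lintegral_ofReal (hf.integrable_norm_pow two_ne_zero)
    (Eventually.of_forall fun x => by positivity)).symm

lemma IsCoupling.mem2_of_cost_ne_top (h : IsCoupling μ η π) (hμ : Mem2 μ)
    (hc : ∫⁻ z, ENNReal.ofReal (‖z.1 - z.2‖ ^ 2) ∂(π : Measure (Euc d × Euc d)) ≠ ∞) :
    Mem2 η := by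
  have h1 : MemLp (fun z => z.1 - z.2) 2 (π : Measure (Euc d × Euc d)) := by
    refine (memLp_two_iff_integrable_sq_norm (by fun_prop)).2
      ⟨by fun_prop, ?_⟩
    rw [hasFiniteIntegral_iff_ofReal (Eventually.of_forall fun x => by positivity)]
    exact hc.lt_top
  have h2 : MemLp (fun z => z.2) 2 (π : Measure (Euc d × Euc d)) := by
    refine ((h.memLp_fst hμ.memLp).sub h1).ae_eq (Eventually.of_forall fun z => ?_)
    simp
  have h3 : MemLp id 2 (η : Measure (Euc d)) := by
    rw [← h.2, memLp_map_measure_iff aestronglyMeasurable_id measurable_snd.aemeasurable]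
    exact h2
  exact (memLp_two_iff_integrable_sq_norm aestronglyMeasurable_id).1 h3

lemma IsCoupling.memLp_fst_sub_snd (h : IsCoupling μ η π) (hμ : Mem2 μ) (hη : Mem2 η) :
    MemLp (fun z => z.1 - z.2) 2 (π : Measure (Euc d × Euc d)) :=
  (h.memLp_fst hμ.memLp).sub (h.memLp_snd hη.memLp)

namespace IsBaryProjection

variable {T : Euc d → Euc d}

lemma le_W2sq (hT : IsBaryProjection μ ν T) (hμ : Mem2 μ) (hord : ConvexOrder η ν) :
    ∫⁻ x, ENNReal.ofReal (‖x - T x‖ ^ 2) ∂(μ : Measure (Euc d)) ≤ W2sq μ η := by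
  refine le_iInf₂ fun π h => ?_
  by_cases hc : ∫⁻ z, ENNReal.ofReal (‖z.1 - z.2‖ ^ 2) ∂(π : Measure (Euc d × Euc d)) = ∞
  · exact hc ▸ le_top
  have hη := h.mem2_of_cost_ne_top hμ hc
  have h1 := hT.integral_coupling_le hμ hη hord h
  have h2 : 0 ≤ ∫ z, ‖z.2 - T z.1‖ ^ 2 ∂(π : Measure (Euc d × Euc d)) :=
    integral_nonneg fun z => by positivity
  rw [lintegral_ofReal_norm_sq (hT.memLp_id_sub hμ), lintegral_ofReal_norm_sq
    (h.memLp_fst_sub_snd hμ hη)]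
  refine ENNReal.ofReal_le_ofReal ?_
  linarith

lemma W2sq_map_le {S : Euc d → Euc d} (hS : Measurable S)
    (hη : (η : Measure (Euc d)) = (μ : Measure (Euc d)).map S) :
    W2sq μ η ≤ ∫⁻ x, ENNReal.ofReal (‖x - S x‖ ^ 2) ∂(μ : Measure (Euc d)) := by
  have hm : Measurable fun x => (x, S x) := measurable_id.prodMk hS
  let π : ProbabilityMeasure (Euc d × Euc d) :=
    ⟨(μ : Measure (Euc d)).map fun x => (x, S x), Measure.isProbabilityMeasure_map hm.aemeasurable⟩
  have hπ : IsCoupling μ η π := by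
    constructor
    · change Measure.map _ (Measure.map _ _) = _
      rw [Measure.map_map measurable_fst hm]
      exact Measure.map_id
    · change Measure.map _ (Measure.map _ _) = _
      rw [Measure.map_map measurable_snd hm, hη]
      rfl
  refine (iInf₂_le π hπ).trans_eq ?_
  change ∫⁻ z, _ ∂(Measure.map _ _) = _
  rw [lintegral_map (by fun_prop) hm]

lemma V2sq_eq (hT : IsBaryProjection μ ν T) (hμ : Mem2 μ) :
    V2sq μ ν = ∫⁻ x, ENNReal.ofReal (‖x - T x‖ ^ 2) ∂(μ : Measure (Euc d)) := by
  refine le_antisymm ?_ (le_iInf₂ fun η h => hT.le_W2sq hμ h)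
  let η : ProbabilityMeasure (Euc d) :=
    ⟨(μ : Measure (Euc d)).map T, Measure.isProbabilityMeasure_map hT.measurable.aemeasurable⟩
  have hη : ConvexOrder η ν := by
    intro φ hφ hK
    refine le_of_eq_of_le ?_ (hT.integral_comp_le φ ⟨hφ, hK⟩)
    exact integral_map hT.measurable.aemeasurable
      (ConvexTest.continuous ⟨hφ, hK⟩).aestronglyMeasurable
  exact (iInf₂_le η hη).trans (W2sq_map_le hT.measurable rfl)

lemma le_weakCost2 (hT : IsBaryProjection μ ν T) (hμ : Mem2 μ) (hν : Mem2 ν)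
    (h : IsCoupling μ ν π) :
    ENNReal.ofReal (∫ x, ‖x - T x‖ ^ 2 ∂(μ : Measure (Euc d)) +
      ∫ x, ‖baryMap π x - T x‖ ^ 2 ∂(μ : Measure (Euc d))) ≤ weakCost2 μ π := by
  have hb := h.memLp_baryMap hν
  have hbm := h.baryMap_mem_admissibleMaps hν (fun φ _ _ => le_refl _)
  refine (ENNReal.ofReal_le_ofReal (hT.integral_add_integral_le hμ hb fun φ hφ => ?_)).trans_eq
    (lintegral_ofReal_norm_sq (hμ.memLp.sub hb)).symm
  refine le_of_eq_of_le (integral_congr_ae ?_) (hbm φ hφ)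
  filter_upwards [hb.coeFn_toLp] with x hx
  rw [hx]

lemma baryMap_ae_eq (hT : IsBaryProjection μ ν T) (hμ : Mem2 μ) (hν : Mem2 ν)
    (h : IsCoupling μ ν π)
    (hopt : weakCost2 μ π ≤ ∫⁻ x, ENNReal.ofReal (‖x - T x‖ ^ 2) ∂(μ : Measure (Euc d))) :
    baryMap π =ᵐ[(μ : Measure (Euc d))] T := by
  have hd : MemLp (fun x => baryMap π x - T x) 2 (μ : Measure (Euc d)) :=
    (h.memLp_baryMap hν).sub hT.memLp
  have h1 := (hT.le_weakCost2 hμ hν h).trans hopt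
  rw [lintegral_ofReal_norm_sq (hT.memLp_id_sub hμ),
    ENNReal.ofReal_le_ofReal_iff (integral_nonneg fun x => by positivity)] at h1
  have h2 : 0 ≤ ∫ x, ‖baryMap π x - T x‖ ^ 2 ∂(μ : Measure (Euc d)) :=
    integral_nonneg fun x => by positivity
  have h3 := (integral_eq_zero_iff_of_nonneg (fun x => by positivity)
    (hd.integrable_norm_pow two_ne_zero)).1 (le_antisymm (by linarith) h2)
  filter_upwards [h3] with x hx
  exact sub_eq_zero.1 (norm_eq_zero.1 (pow_eq_zero_iff two_ne_zero |>.1 hx))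

lemma eq_map_of_W2sq_le (hT : IsBaryProjection μ ν T) (hμ : Mem2 μ) (hη : Mem2 η)
    (hord : ConvexOrder η ν)
    (hopt : W2sq μ η ≤ ∫⁻ x, ENNReal.ofReal (‖x - T x‖ ^ 2) ∂(μ : Measure (Euc d))) :
    (η : Measure (Euc d)) = (μ : Measure (Euc d)).map T := by
  have hid := hT.memLp_id_sub hμ
  have hclose : ∀ ε > 0, ∃ π, IsCoupling μ η π ∧
      ∫ z, ‖z.2 - T z.1‖ ^ 2 ∂(π : Measure (Euc d × Euc d)) < ε := by
    intro ε hε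
    set D := ∫ x, ‖x - T x‖ ^ 2 ∂(μ : Measure (Euc d))
    have hD : 0 ≤ D := integral_nonneg fun x => by positivity
    rw [lintegral_ofReal_norm_sq hid] at hopt
    have hlt : W2sq μ η < ENNReal.ofReal (D + ε) :=
      hopt.trans_lt ((ENNReal.ofReal_lt_ofReal_iff (by linarith)).2 (by linarith))
    simp only [W2sq, iInf_lt_iff] at hlt
    obtain ⟨π, h, hπ⟩ := hlt
    refine ⟨π, h, ?_⟩
    rw [lintegral_ofReal_norm_sq (h.memLp_fst_sub_snd hμ hη),
      ENNReal.ofReal_lt_ofReal_iff (by linarith)] at hπ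
    have := hT.integral_coupling_le hμ hη hord h
    linarith
  have hTm := Measure.isProbabilityMeasure_map (μ := (μ : Measure (Euc d)))
    hT.measurable.aemeasurable
  refine Measure.ext_of_charFun (funext fun t => ?_)
  rw [charFun_apply, charFun_apply, integral_map hT.measurable.aemeasurable (by fun_prop)]
  refine eq_of_forall_dist_le fun ε hε => ?_
  obtain ⟨π, h, hπ⟩ := hclose ((ε / (‖t‖ + 1)) ^ 2) (by positivity)
  have hTsq : MemLp (fun z => z.2 - T z.1) 2 (π : Measure (Euc d × Euc d)) :=
    (h.memLp_snd hη.memLp).sub (h.memLp_fst hT.memLp)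
  have hnorm : Integrable (fun z => ‖z.2 - T z.1‖) (π : Measure (Euc d × Euc d)) :=
    (hTsq.integrable one_le_two).norm
  have hL1 : ∫ z, ‖z.2 - T z.1‖ ∂(π : Measure (Euc d × Euc d)) ≤ ε / (‖t‖ + 1) := by
    refine le_of_lt (lt_of_pow_lt_pow_left₀ 2 (by positivity) (lt_of_le_of_lt ?_ hπ))
    exact (convexOn_pow 2).map_integral_le (by fun_prop) isClosed_Ici
      (Eventually.of_forall fun z => norm_nonneg _) hnorm (hTsq.integrable_norm_pow two_ne_zero)
  set e : Euc d → ℂ := fun x => Complex.exp (⟪x, t⟫ * Complex.I) with he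
  have hemeas : Measurable e := by fun_prop
  have henorm : ∀ x, ‖e x‖ = 1 := fun x => Complex.norm_exp_ofReal_mul_I _
  have hediff : ∀ x y, ‖e y - e x‖ ≤ ‖y - x‖ * ‖t‖ := by
    intro x y
    have h1 : e y - e x = e x * (Complex.exp (Complex.I * (⟪y - x, t⟫ : ℝ)) - 1) := by
      simp only [he]
      rw [mul_sub, ← Complex.exp_add, mul_one, inner_sub_left]
      push_cast
      ring_nf
    rw [h1, norm_mul, henorm, one_mul]
    exact (Real.norm_exp_I_mul_ofReal_sub_one_le).trans (norm_inner_le_norm _ _)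
  have hcomp : ∀ f : Euc d × Euc d → Euc d, Measurable f →
      Integrable (fun z => e (f z)) (π : Measure (Euc d × Euc d)) := fun f hf =>
    (integrable_const (1 : ℝ)).mono' (hemeas.comp hf).aestronglyMeasurable
      (Eventually.of_forall fun z => (henorm _).le)
  rw [← h.integral_snd (f := e) hemeas.aestronglyMeasurable,
    ← h.integral_fst (f := fun x => e (T x)) (hemeas.comp hT.measurable).aestronglyMeasurable,
    dist_eq_norm, ← integral_sub (hcomp _ measurable_snd)
      (hcomp (fun z => T z.1) (hT.measurable.comp measurable_fst))]
  calc ‖∫ z, (e z.2 - e (T z.1)) ∂(π : Measure (Euc d × Euc d))‖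
      ≤ ∫ z, ‖z.2 - T z.1‖ * ‖t‖ ∂(π : Measure (Euc d × Euc d)) :=
        norm_integral_le_of_norm_le (hnorm.mul_const _) (Eventually.of_forall fun z => hediff _ _)
    _ = (∫ z, ‖z.2 - T z.1‖ ∂(π : Measure (Euc d × Euc d))) * ‖t‖ := integral_mul_const _ _
    _ ≤ ε / (‖t‖ + 1) * (‖t‖ + 1) := by
      gcongr
      linarith
    _ = ε := div_mul_cancel₀ _ (by positivity)

end IsBaryProjection

end Projection

lemma integral_indicator_const_mul {α : Type*} [MeasurableSpace α] {m : Measure α} {A : Set α}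
    (hA : MeasurableSet A) (c : ℝ) (g : α → ℝ) :
    ∫ x, A.indicator (fun _ => c) x * g x ∂m = c * ∫ x in A, g x ∂m := by
  rw [← integral_const_mul, ← integral_indicator hA]
  refine integral_congr_ae (Eventually.of_forall fun x => ?_)
  by_cases hx : x ∈ A <;> simp [hx]

lemma MeasureTheory.Integrable.indicator_const_mul {α : Type*} [MeasurableSpace α] {m : Measure α}
    {A : Set α} (hA : MeasurableSet A) (c : ℝ) {g : α → ℝ} (hg : Integrable g m) :
    Integrable (fun x => A.indicator (fun _ => c) x * g x) m := by
  refine ((hg.const_mul c).indicator hA).congr (Eventually.of_forall fun x => ?_)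
  by_cases hx : x ∈ A <;> simp [hx]

namespace IsBaryProjection

variable {μ ν : ProbabilityMeasure (Euc d)} {T : Euc d → Euc d}

/-- Moving mass of the projection cyclically between sets does not increase the correlation. -/
lemma sum_setAverage_inner_le (hT : IsBaryProjection μ ν T) (hμ : Mem2 μ) {n : ℕ}
    {A : ℕ → Set (Euc d)} (hA : ∀ i, MeasurableSet (A i))
    (hpos : ∀ i, (μ : Measure (Euc d)) (A i) ≠ 0) (hcycle : A n = A 0) :
    ∑ i ∈ Finset.range n, ⨍ x in A i,
      ⟪x - T x, (⨍ y in A (i + 1), T y ∂(μ : Measure (Euc d))) - T x⟫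
        ∂(μ : Measure (Euc d)) ≤ 0 := by
  set a : ℕ → Euc d := fun i => ⨍ y in A i, T y ∂(μ : Measure (Euc d)) with ha
  set m : ℕ → ℝ := fun i => (μ : Measure (Euc d)).real (A i) with hm
  have hm0 : ∀ i, 0 < m i := fun i => ENNReal.toReal_pos (hpos i) (measure_ne_top _ _)
  set ε : ℝ := (1 + ∑ i ∈ Finset.range n, (m i)⁻¹)⁻¹ with hεdef
  have hsum0 : 0 ≤ ∑ i ∈ Finset.range n, (m i)⁻¹ :=
    Finset.sum_nonneg fun i _ => (inv_pos.2 (hm0 i)).le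
  have hε : 0 < ε := by positivity
  set w : ℕ → Euc d → ℝ := fun i => (A i).indicator fun _ => ε * (m i)⁻¹ with hw
  have hw0 : ∀ i x, 0 ≤ w i x := fun i x =>
    Set.indicator_nonneg (fun _ _ => mul_nonneg hε.le (inv_pos.2 (hm0 i)).le) x
  have hwle : ∀ i x, w i x ≤ ε * (m i)⁻¹ := fun i x =>
    Set.indicator_le_self' (fun _ _ => mul_nonneg hε.le (inv_pos.2 (hm0 i)).le) x
  have hw1 : ∀ x, ∑ i ∈ Finset.range n, w i x ≤ 1 := fun x => by
    refine (Finset.sum_le_sum fun i _ => hwle i x).trans ?_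
    rw [← Finset.mul_sum, hεdef, inv_mul_le_iff₀ (by positivity)]
    linarith
  have hTi : Integrable T (μ : Measure (Euc d)) := hT.memLp.integrable one_le_two
  have hshift : ∀ i, MemLp (fun x => a (i + 1) - T x) 2 (μ : Measure (Euc d)) := fun i =>
    (memLp_const _).sub hT.memLp
  have hstep : ∀ i, MemLp (fun x => w i x • (a (i + 1) - T x)) 2 (μ : Measure (Euc d)) := by
    intro i
    refine (((hshift i).const_smul (ε * (m i)⁻¹)).indicator (hA i)).ae_eq
      (Eventually.of_forall fun x => ?_)
    by_cases hx : x ∈ A i <;> simp [hw, hx]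
  set f : Euc d → Euc d := fun x => T x + ∑ i ∈ Finset.range n, w i x • (a (i + 1) - T x)
    with hf
  have hfmem : MemLp f 2 (μ : Measure (Euc d)) :=
    hT.memLp.add (memLp_finsetSum _ fun i _ => hstep i)
  have hfν : ∀ φ : Euc d → ℝ, ConvexTest φ →
      ∫ x, φ (f x) ∂(μ : Measure (Euc d)) ≤ ∫ y, φ y ∂(ν : Measure (Euc d)) := by
    intro φ hφ
    refine le_trans ?_ (hT.integral_comp_le φ hφ)
    have hφi := hφ.integrable_comp hTi
    have hpt : ∀ x, φ (f x) ≤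
        φ (T x) + ∑ i ∈ Finset.range n, w i x * (φ (a (i + 1)) - φ (T x)) := by
      intro x
      have h := hφ.1.map_add_sum_le (t := Finset.range n) (w := fun i => w i x)
        (p := fun i => a (i + 1)) (v := 1 - ∑ i ∈ Finset.range n, w i x) (q := T x)
        (fun i _ => hw0 i x) (by ring) (fun _ _ => Set.mem_univ _)
        (sub_nonneg.2 (hw1 x)) (Set.mem_univ _)
      have h1 : f x = (1 - ∑ i ∈ Finset.range n, w i x) • T x +
          ∑ i ∈ Finset.range n, w i x • a (i + 1) := by
        simp only [hf, smul_sub, Finset.sum_sub_distrib, ← Finset.sum_smul, sub_smul, one_smul]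
        abel
      rw [h1]
      refine h.trans_eq ?_
      simp only [smul_eq_mul, mul_sub, Finset.sum_sub_distrib, ← Finset.sum_mul, sub_mul, one_mul]
      ring
    have hterm : ∀ i, Integrable (fun x => w i x * (φ (a (i + 1)) - φ (T x)))
        (μ : Measure (Euc d)) := fun i =>
      ((integrable_const _).sub hφi).indicator_const_mul (hA i) _
    have hsumi : Integrable (fun x => ∑ i ∈ Finset.range n, w i x * (φ (a (i + 1)) - φ (T x)))
        (μ : Measure (Euc d)) := integrable_finsetSum _ fun i _ => hterm i
    have hle : ∫ x, φ (f x) ∂(μ : Measure (Euc d)) ≤ ∫ x, (φ (T x) +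
        ∑ i ∈ Finset.range n, w i x * (φ (a (i + 1)) - φ (T x))) ∂(μ : Measure (Euc d)) :=
      integral_mono (hφ.integrable_comp (hfmem.integrable one_le_two)) (hφi.add hsumi) hpt
    refine hle.trans ?_
    rw [integral_add hφi hsumi, integral_finsetSum _ fun i _ => hterm i]
    have hval : ∀ i, ∫ x, w i x * (φ (a (i + 1)) - φ (T x)) ∂(μ : Measure (Euc d)) =
        ε * (φ (a (i + 1)) - ⨍ x in A i, φ (T x) ∂(μ : Measure (Euc d))) := by
      intro i
      rw [integral_indicator_const_mul (hA i), integral_sub (integrable_const _) hφi.integrableOn,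
        setIntegral_const, setAverage_eq, smul_eq_mul, smul_eq_mul]
      have : (μ : Measure (Euc d)).real (A i) ≠ 0 := (hm0 i).ne'
      simp only [hm]
      field_simp
    simp_rw [hval]
    rw [← Finset.mul_sum, Finset.sum_sub_distrib]
    have havg : ∀ i, φ (a i) ≤ ⨍ x in A i, φ (T x) ∂(μ : Measure (Euc d)) := fun i =>
      hφ.1.map_set_average_le hφ.continuous.continuousOn isClosed_univ (hpos i)
        (measure_ne_top _ _) (by simp) hTi.integrableOn hφi.integrableOn
    have hsum : ∑ i ∈ Finset.range n, φ (a (i + 1)) ≤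
        ∑ i ∈ Finset.range n, ⨍ x in A i, φ (T x) ∂(μ : Measure (Euc d)) := by
      refine (Finset.sum_le_sum fun i _ => havg (i + 1)).trans_eq ?_
      have h1 := Finset.sum_range_succ
        (fun i => ⨍ x in A i, φ (T x) ∂(μ : Measure (Euc d))) n
      rw [Finset.sum_range_succ', hcycle] at h1
      exact add_right_cancel h1
    have := mul_nonneg hε.le (sub_nonneg.2 hsum)
    linarith
  have hvar := hT.integral_inner_le f hfmem hfν
  have hid := hT.memLp_id_sub hμ
  have hexp : ∀ x, ⟪x - T x, f x - T x⟫ =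
      ∑ i ∈ Finset.range n, w i x * ⟪x - T x, a (i + 1) - T x⟫ := fun x => by
    simp only [hf, add_sub_cancel_left, inner_sum, real_inner_smul_right]
  have hterm : ∀ i, Integrable (fun x => w i x * ⟪x - T x, a (i + 1) - T x⟫)
      (μ : Measure (Euc d)) := fun i =>
    (hid.integrable_real_inner (hshift i)).indicator_const_mul (hA i) _
  simp_rw [hexp] at hvar
  rw [integral_finsetSum _ fun i _ => hterm i] at hvar
  simp_rw [hw, integral_indicator_const_mul (hA _), mul_assoc] at hvar
  rw [← Finset.mul_sum] at hvar
  refine nonpos_of_mul_nonpos_right (hvar.trans_eq' ?_) hε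
  exact congrArg _ (Finset.sum_congr rfl fun i _ => (setAverage_eq _ _ _).symm)

/-- The graph of the projection is supported on a firmly cyclically monotone set. -/
lemma sum_support_le (hT : IsBaryProjection μ ν T) (hμ : Mem2 μ) {n : ℕ}
    {f : ℕ → Euc d × Euc d}
    (hf : ∀ i, f i ∈ ((μ : Measure (Euc d)).map fun x => (x, T x)).support)
    (hcycle : f n = f 0) :
    ∑ i ∈ Finset.range n, ⟪(f i).1 - (f i).2, (f (i + 1)).2 - (f i).2⟫ ≤ 0 := by
  have hgm : Measurable fun x => (x, T x) := measurable_id.prodMk hT.measurable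
  refine le_of_forall_pos_le_add fun δ hδ => ?_
  rw [zero_add]
  set δ' := δ / (n + 1) with hδ'
  have hδ'0 : 0 < δ' := by positivity
  have hev : ∀ i, ∀ᶠ r in 𝓝[>] (0 : ℝ), ∀ z ∈ Metric.ball (f i) r,
      ∀ v ∈ Metric.closedBall (f (i + 1)).2 r,
        ⟪(f i).1 - (f i).2, (f (i + 1)).2 - (f i).2⟫ - δ' ≤ ⟪z.1 - z.2, v - z.2⟫ := by
    intro i
    have hcont : Continuous fun q : (Euc d × Euc d) × Euc d => ⟪q.1.1 - q.1.2, q.2 - q.1.2⟫ := by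
      fun_prop
    obtain ⟨ρ, hρ, hball⟩ := Metric.eventually_nhds_iff_ball.1
      ((hcont.tendsto (f i, (f (i + 1)).2)).eventually_const_le (sub_lt_self _ hδ'0))
    filter_upwards [Ioo_mem_nhdsGT hρ] with r hr z hz v hv
    refine hball (z, v) ?_
    rw [← ball_prod_same]
    exact ⟨Metric.ball_subset_ball hr.2.le hz, Metric.closedBall_subset_ball hr.2 hv⟩
  obtain ⟨r, hr, hr0⟩ := (((Finset.eventually_all (Finset.range n)).2 fun i _ => hev i).and
    self_mem_nhdsWithin).exists
  set A : ℕ → Set (Euc d) := fun i => (fun x => (x, T x)) ⁻¹' Metric.ball (f i) r with hAdef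
  have hA : ∀ i, MeasurableSet (A i) := fun i => hgm Metric.isOpen_ball.measurableSet
  have hpos : ∀ i, (μ : Measure (Euc d)) (A i) ≠ 0 := fun i => by
    have h := (Measure.mem_support_iff_forall _).1 (hf i) _ (Metric.ball_mem_nhds _ hr0)
    rw [Measure.map_apply hgm Metric.isOpen_ball.measurableSet] at h
    exact h.ne'
  have hmain := hT.sum_setAverage_inner_le hμ (n := n) hA hpos (by simp only [hAdef, hcycle])
  have hTi : Integrable T (μ : Measure (Euc d)) := hT.memLp.integrable one_le_two
  have hmean : ∀ i, (⨍ y in A i, T y ∂(μ : Measure (Euc d))) ∈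
      Metric.closedBall (f i).2 r := fun i => by
    refine (convex_closedBall _ _).set_average_mem Metric.isClosed_closedBall (hpos i)
      (measure_ne_top _ _) ?_ hTi.integrableOn
    refine (ae_restrict_iff' (hA i)).2 (Eventually.of_forall fun x hx => ?_)
    have hx' : (x, T x) ∈ Metric.ball (f i) r := hx
    rw [← Prod.mk.eta (p := f i), ← ball_prod_same] at hx'
    exact Metric.ball_subset_closedBall hx'.2
  have hbound : ∀ i ∈ Finset.range n,
      ⟪(f i).1 - (f i).2, (f (i + 1)).2 - (f i).2⟫ - δ' ≤ ⨍ x in A i,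
        ⟪x - T x, (⨍ y in A (i + 1), T y ∂(μ : Measure (Euc d))) - T x⟫
          ∂(μ : Measure (Euc d)) := by
    intro i hi
    refine (convex_Ici (𝕜 := ℝ) (_ : ℝ)).set_average_mem isClosed_Ici (hpos i) (measure_ne_top _ _) ?_ ?_
    · refine (ae_restrict_iff' (hA i)).2 (Eventually.of_forall fun x hx => ?_)
      exact hr i hi _ hx _ (hmean (i + 1))
    · exact ((hT.memLp_id_sub hμ).integrable_real_inner
        ((memLp_const _).sub hT.memLp)).integrableOn
  have hsum := (Finset.sum_le_sum hbound).trans hmain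
  rw [Finset.sum_sub_distrib, Finset.sum_const, Finset.card_range, nsmul_eq_mul] at hsum
  have : n * δ' ≤ δ := by
    rw [hδ', mul_div_assoc', div_le_iff₀ (by positivity)]
    nlinarith
  linarith

/-- The projection is the gradient of a convex function with `1`-Lipschitz gradient. -/
lemma exists_gradient (hT : IsBaryProjection μ ν T) (hμ : Mem2 μ) :
    ∃ φ : Euc d → ℝ, ConvexOn ℝ Set.univ φ ∧ Differentiable ℝ φ ∧ LipschitzWith 1 (gradient φ) ∧
      gradient φ =ᵐ[(μ : Measure (Euc d))] T := by
  have hgm : Measurable fun x => (x, T x) := measurable_id.prodMk hT.measurable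
  have := Measure.isProbabilityMeasure_map (μ := (μ : Measure (Euc d))) hgm.aemeasurable
  obtain ⟨p₀, hp₀⟩ := Measure.nonempty_support
    (IsProbabilityMeasure.ne_zero ((μ : Measure (Euc d)).map fun x => (x, T x)))
  obtain ⟨φ, h1, h2, h3, h4⟩ := exists_gradient_of_cyclic hp₀ fun r hr => by
    obtain ⟨n, f, hf, h0, hn, rfl⟩ := hr.exists_chain hp₀
    exact hT.sum_support_le hμ hf (hn.trans h0.symm)
  refine ⟨φ, h1, h2, h3, ?_⟩
  filter_upwards [ae_of_ae_map hgm.aemeasurable (Measure.support_mem_ae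
    (μ := (μ : Measure (Euc d)).map fun x => (x, T x)))] with x hx
  exact h4 _ hx

end IsBaryProjection

section Partition

variable {ι : Type*} [Fintype ι]

/-- A measurable partition of unity. -/
structure IsUnityPartition (f : ι → Euc d → ℝ) : Prop where
  measurable : ∀ j, Measurable (f j)
  nonneg : ∀ j y, 0 ≤ f j y
  sum_eq_one : ∀ y, ∑ j, f j y = 1

namespace IsUnityPartition

variable {f g : ι → Euc d → ℝ}

lemma le_one (hf : IsUnityPartition f) (j : ι) (y : Euc d) : f j y ≤ 1 :=
  (Finset.single_le_sum (fun i _ => hf.nonneg i y) (Finset.mem_univ j)).trans_eq (hf.sum_eq_one y)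

lemma integrable_smul {F : Type*} [NormedAddCommGroup F] [NormedSpace ℝ F]
    (hf : IsUnityPartition f) (j : ι) {p : Measure (Euc d)} {h : Euc d → F}
    (hh : Integrable h p) : Integrable (fun y => f j y • h y) p := by
  refine hh.mono ((hf.measurable j).aestronglyMeasurable.smul hh.1)
    (Eventually.of_forall fun y => ?_)
  rw [norm_smul, Real.norm_of_nonneg (hf.nonneg j y)]
  exact mul_le_of_le_one_left (norm_nonneg _) (hf.le_one j y)

lemma convex_comb (hf : IsUnityPartition f) (hg : IsUnityPartition g) {a b : ℝ} (ha : 0 ≤ a)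
    (hb : 0 ≤ b) (hab : a + b = 1) : IsUnityPartition fun j y => a * f j y + b * g j y where
  measurable j := ((hf.measurable j).const_mul a).add ((hg.measurable j).const_mul b)
  nonneg j y := add_nonneg (mul_nonneg ha (hf.nonneg j y)) (mul_nonneg hb (hg.nonneg j y))
  sum_eq_one y := by
    rw [Finset.sum_add_distrib, ← Finset.mul_sum, ← Finset.mul_sum, hf.sum_eq_one, hg.sum_eq_one,
      mul_one, mul_one, hab]

end IsUnityPartition

lemma integrable_one_prod {p : Measure (Euc d)} [IsFiniteMeasure p] (hp : Integrable id p) :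
    Integrable (fun y : Euc d => ((1 : ℝ), y)) p :=
  (integrable_const _).prodMk hp

/-- The masses and first moments of the pieces of `p` cut out by partitions of unity. -/
def partitionMoments (ι : Type*) [Fintype ι] (p : Measure (Euc d)) : Set (ι → ℝ × Euc d) :=
  {v | ∃ f : ι → Euc d → ℝ, IsUnityPartition f ∧ ∀ j, v j = ∫ y, f j y • ((1 : ℝ), y) ∂p}

lemma convex_partitionMoments {p : Measure (Euc d)} [IsFiniteMeasure p] (hp : Integrable id p) :
    Convex ℝ (partitionMoments ι p) := by
  rintro v ⟨f, hf, hv⟩ w ⟨g, hg, hw⟩ a b ha hb hab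
  refine ⟨_, hf.convex_comb hg ha hb hab, fun j => ?_⟩
  have h1 : Integrable (fun y => a • f j y • ((1 : ℝ), y)) p :=
    (hf.integrable_smul j (integrable_one_prod hp)).smul a
  have h2 : Integrable (fun y => b • g j y • ((1 : ℝ), y)) p :=
    (hg.integrable_smul j (integrable_one_prod hp)).smul b
  simp only [add_smul, mul_smul]
  rw [integral_add h1 h2, integral_smul, integral_smul, ← hv, ← hw]
  rfl

variable [Nonempty ι]

/-- The maximum of finitely many affine functions. -/
def affineMax (L : ι → ℝ × Euc d →L[ℝ] ℝ) (y : Euc d) : ℝ :=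
  Finset.univ.sup' Finset.univ_nonempty fun j => L j (1, y)

lemma le_affineMax (L : ι → ℝ × Euc d →L[ℝ] ℝ) (j : ι) (y : Euc d) :
    L j (1, y) ≤ affineMax L y :=
  Finset.le_sup' (fun j => L j (1, y)) (Finset.mem_univ j)

lemma convexTest_affineMax (L : ι → ℝ × Euc d →L[ℝ] ℝ) : ConvexTest (affineMax L) := by
  refine ⟨⟨convex_univ, fun x _ y _ a b ha hb hab => Finset.sup'_le _ _ fun j _ => ?_⟩,
    ∑ j, ‖L j‖, fun y => ?_⟩
  · have h1 : ((1 : ℝ), a • x + b • y) = a • ((1 : ℝ), x) + b • ((1 : ℝ), y) := by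
      simp [hab]
    rw [h1, map_add, map_smul, map_smul]
    have := le_affineMax L j x
    have := le_affineMax L j y
    gcongr
  · obtain ⟨j, hj, hjy⟩ := Finset.exists_mem_eq_sup' Finset.univ_nonempty fun j => L j (1, y)
    rw [affineMax, hjy]
    refine ((L j).le_opNorm _).trans ?_
    gcongr
    · exact Finset.single_le_sum (fun i _ => norm_nonneg (L i)) hj
    · refine max_le ?_ ?_ <;> simp [norm_nonneg]

/-- Some partition of unity is carried by the sets where the affine functions are maximal. -/
lemma exists_isUnityPartition_argmax (L : ι → ℝ × Euc d →L[ℝ] ℝ) :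
    ∃ f : ι → Euc d → ℝ, IsUnityPartition f ∧ ∀ y, ∑ j, f j y * L j (1, y) = affineMax L y := by
  set A : ι → Set (Euc d) := fun j => {y | L j (1, y) = affineMax L y} with hAdef
  have hA : ∀ j, MeasurableSet (A j) := fun j =>
    (isClosed_eq (by fun_prop) (convexTest_affineMax L).continuous).measurableSet
  set s : Euc d → ℝ := fun y => ∑ j, (A j).indicator 1 y with hs
  have h0 : ∀ j y, 0 ≤ (A j).indicator (1 : Euc d → ℝ) y := fun j y =>
    Set.indicator_nonneg (fun _ _ => zero_le_one) y
  have hs0 : ∀ y, 0 < s y := fun y => by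
    obtain ⟨j, hj, hjy⟩ := Finset.exists_mem_eq_sup' Finset.univ_nonempty fun j => L j (1, y)
    have hjA : y ∈ A j := hjy.symm
    refine Finset.sum_pos' (fun i _ => h0 i y) ⟨j, hj, ?_⟩
    simp [Set.indicator_of_mem hjA]
  have hind : ∀ j, Measurable ((A j).indicator (1 : Euc d → ℝ)) := fun j =>
    measurable_one.indicator (hA j)
  have hf : IsUnityPartition fun j y => (A j).indicator (1 : Euc d → ℝ) y / s y :=
    { measurable := fun j => (hind j).div (Finset.measurable_sum _ fun i _ => hind i)
      nonneg := fun j y => div_nonneg (h0 j y) (hs0 y).le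
      sum_eq_one := fun y => by rw [← Finset.sum_div, div_self (hs0 y).ne'] }
  refine ⟨_, hf, fun y => ?_⟩
  have h1 : ∀ j, (A j).indicator (1 : Euc d → ℝ) y / s y * L j (1, y) =
      (A j).indicator (1 : Euc d → ℝ) y / s y * affineMax L y := fun j => by
    by_cases hy : y ∈ A j
    · rw [show L j (1, y) = affineMax L y from hy]
    · simp [hy]
  rw [Finset.sum_congr rfl fun j _ => h1 j, ← Finset.sum_mul, hf.sum_eq_one, one_mul]

/-- Moments dominated by the maxima of affine functions are approximated by partitions. -/
lemma mem_closure_partitionMoments {p : Measure (Euc d)} [IsFiniteMeasure p]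
    (hp : Integrable id p) {w : ι → ℝ × Euc d}
    (hw : ∀ L : ι → ℝ × Euc d →L[ℝ] ℝ, ∑ j, L j (w j) ≤ ∫ y, affineMax L y ∂p) :
    w ∈ closure (partitionMoments ι p) := by
  classical
  by_contra h
  obtain ⟨Λ, u, hu, hwu⟩ := geometric_hahn_banach_closed_point
    (convex_partitionMoments (ι := ι) hp).closure isClosed_closure h
  set L : ι → ℝ × Euc d →L[ℝ] ℝ := fun j =>
    Λ.comp (ContinuousLinearMap.single ℝ (fun _ => ℝ × Euc d) j) with hL
  have hsum : ∀ v : ι → ℝ × Euc d, Λ v = ∑ j, L j (v j) := fun v => by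
    conv_lhs => rw [← Finset.univ_sum_single v, map_sum]
    rfl
  obtain ⟨f, hf, hfL⟩ := exists_isUnityPartition_argmax L
  have h1 := hu _ (subset_closure ⟨f, hf, fun j => rfl⟩)
  have hi := fun j => hf.integrable_smul j (integrable_one_prod hp)
  have h2 : ∑ j, L j (∫ y, f j y • ((1 : ℝ), y) ∂p) = ∫ y, affineMax L y ∂p := by
    simp_rw [← ContinuousLinearMap.integral_comp_comm _ (hi _)]
    rw [← integral_finsetSum _ fun j _ => (L j).integrable_comp (hi j)]
    refine integral_congr_ae (Eventually.of_forall fun y => ?_)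
    simpa only [map_smul, smul_eq_mul] using hfL y
  rw [hsum, h2] at h1
  rw [hsum] at hwu
  linarith [hw L]

/-- The approximating partitions can be chosen with exact masses. -/
lemma exists_isUnityPartition_moments {p : Measure (Euc d)} [IsProbabilityMeasure p]
    (hp : Integrable id p) {w : ι → ℝ × Euc d} (hpos : ∀ j, 0 < (w j).1)
    (hsum : ∑ j, (w j).1 = 1)
    (hw : ∀ L : ι → ℝ × Euc d →L[ℝ] ℝ, ∑ j, L j (w j) ≤ ∫ y, affineMax L y ∂p)
    {δ : ℝ} (hδ : 0 < δ) :
    ∃ f : ι → Euc d → ℝ, IsUnityPartition f ∧ (∀ j, ∫ y, f j y ∂p = (w j).1) ∧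
      ∀ j, ‖∫ y, f j y • y ∂p - (w j).2‖ < δ := by
  set z : Euc d := ∫ y, y ∂p with hz
  set B : ℝ := ∑ j, ‖w j‖ with hB
  have hB0 : 0 ≤ B := Finset.sum_nonneg fun j _ => norm_nonneg _
  have hwB : ∀ j, ‖w j‖ ≤ B := fun j =>
    Finset.single_le_sum (f := fun j => ‖w j‖) (fun i _ => norm_nonneg _) (Finset.mem_univ j)
  set ε : ℝ := min 1 (δ / (3 + B + ‖z‖)) with hε
  have hden : 0 < 3 + B + ‖z‖ := by positivity
  have hε0 : 0 < ε := lt_min one_pos (by positivity)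
  have hε1 : ε ≤ 1 := min_le_left _ _
  have hεδ : ε * (3 + B + ‖z‖) ≤ δ := (le_div_iff₀ hden).1 (min_le_right _ _)
  set c : ℝ := Finset.univ.inf' Finset.univ_nonempty fun j => (w j).1 with hc
  have hc0 : 0 < c := (Finset.lt_inf'_iff _).2 fun j _ => hpos j
  have hcw : ∀ j, c ≤ (w j).1 := fun j => Finset.inf'_le _ (Finset.mem_univ j)
  have hw1 : ∀ j, (w j).1 ≤ 1 := fun j =>
    (Finset.single_le_sum (f := fun j => (w j).1) (fun i _ => (hpos i).le)
      (Finset.mem_univ j)).trans_eq hsum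
  obtain ⟨v, ⟨f, hf, hv⟩, hvw⟩ := Metric.mem_closure_iff.1 (mem_closure_partitionMoments hp hw)
    (ε * c) (mul_pos hε0 hc0)
  have hdist : ∀ j, ‖v j - w j‖ ≤ ε * c := fun j => by
    rw [← dist_eq_norm, dist_comm]
    exact (dist_le_pi_dist w v j).trans hvw.le
  have hv1 : ∀ j, ∫ y, f j y ∂p = (v j).1 := fun j => by
    rw [hv, ← ContinuousLinearMap.coe_fst' (R := ℝ), ← ContinuousLinearMap.integral_comp_comm _
      (hf.integrable_smul j (integrable_one_prod hp))]
    simp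
  have hv2 : ∀ j, ∫ y, f j y • y ∂p = (v j).2 := fun j => by
    rw [hv, ← ContinuousLinearMap.coe_snd' (R := ℝ), ← ContinuousLinearMap.integral_comp_comm _
      (hf.integrable_smul j (integrable_one_prod hp))]
    simp
  have hfi : ∀ j, Integrable (f j) p := fun j => by
    simpa using hf.integrable_smul j (integrable_const (1 : ℝ))
  set e : ι → ℝ := fun j => (w j).1 - (1 - ε) * (v j).1 with he
  have hd1 : ∀ j, |(v j).1 - (w j).1| ≤ ε * c := fun j =>
    (norm_fst_le (v j - w j)).trans (hdist j)
  have he0 : ∀ j, 0 ≤ e j := fun j => by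
    have h1 := (abs_le.1 (hd1 j)).2
    have h2 := mul_le_mul_of_nonneg_left (hcw j) hε0.le
    have h3 : (1 - ε) * ((v j).1 - (w j).1) ≤ (1 - ε) * (ε * c) :=
      mul_le_mul_of_nonneg_left h1 (by linarith)
    have h4 : 0 ≤ ε * (ε * c) := by positivity
    simp only [he]
    nlinarith
  have hvsum : ∑ j, (v j).1 = 1 := by
    simp_rw [← hv1]
    rw [← integral_finsetSum _ fun j _ => hfi j]
    simp [hf.sum_eq_one]
  have hesum : ∑ j, e j = ε := by
    simp only [he]
    rw [Finset.sum_sub_distrib, ← Finset.mul_sum, hsum, hvsum]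
    ring
  have heε : ∀ j, e j ≤ ε := fun j =>
    (Finset.single_le_sum (fun i _ => he0 i) (Finset.mem_univ j)).trans_eq hesum
  refine ⟨fun j y => (1 - ε) * f j y + e j, ?_, fun j => ?_, fun j => ?_⟩
  · exact
      { measurable := fun j => ((hf.measurable j).const_mul _).add_const _
        nonneg := fun j y =>
          add_nonneg (mul_nonneg (by linarith) (hf.nonneg j y)) (he0 j)
        sum_eq_one := fun y => by
          rw [Finset.sum_add_distrib, ← Finset.mul_sum, hf.sum_eq_one, hesum]
          ring }
  · rw [integral_add ((hfi j).const_mul _) (integrable_const _), integral_const_mul, hv1]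
    simp [he]
  · have h1 : ∫ y, ((1 - ε) * f j y + e j) • y ∂p = (1 - ε) • (v j).2 + e j • z := by
      have hi1 : Integrable (fun y => (1 - ε) • f j y • y) p :=
        (hf.integrable_smul j hp).smul (1 - ε)
      have hi2 : Integrable (fun y => e j • y) p := hp.smul (e j)
      simp only [add_smul, mul_smul]
      rw [integral_add hi1 hi2, integral_smul, integral_smul, hv2]
    have h2 : (1 - ε) • (v j).2 + e j • z - (w j).2 =
        (1 - ε) • ((v j).2 - (w j).2) + (e j • z - ε • (w j).2) := by
      module
    rw [h1, h2]
    have h3 : ‖(v j).2 - (w j).2‖ ≤ ε * c := (norm_snd_le (v j - w j)).trans (hdist j)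
    have h4 : ‖(1 - ε) • ((v j).2 - (w j).2)‖ ≤ ε := by
      rw [norm_smul, Real.norm_of_nonneg (by linarith)]
      have : ε * c ≤ ε := mul_le_of_le_one_right hε0.le ((hcw j).trans (hw1 j))
      nlinarith [norm_nonneg ((v j).2 - (w j).2)]
    have h5 : ‖e j • z‖ ≤ ε * ‖z‖ := by
      rw [norm_smul, Real.norm_of_nonneg (he0 j)]
      exact mul_le_mul_of_nonneg_right (heε j) (norm_nonneg _)
    have h6 : ‖ε • (w j).2‖ ≤ ε * B := by
      rw [norm_smul, Real.norm_of_nonneg hε0.le]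
      exact mul_le_mul_of_nonneg_left ((norm_snd_le _).trans (hwB j)) hε0.le
    have h7 := norm_add_le ((1 - ε) • ((v j).2 - (w j).2)) (e j • z - ε • (w j).2)
    have h8 := norm_sub_le (e j • z) (ε • (w j).2)
    nlinarith

end Partition

section Cells

variable {ι : Type*} [Fintype ι] [MeasurableSpace ι] [MeasurableSingletonClass ι]

lemma integral_eq_sum_preimage {α F : Type*} [MeasurableSpace α] [NormedAddCommGroup F]
    [NormedSpace ℝ F] {m : Measure α} {k : α → ι} (hk : Measurable k) {g : α → F}
    (hg : Integrable g m) : ∫ x, g x ∂m = ∑ j, ∫ x in k ⁻¹' {j}, g x ∂m := by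
  rw [← integral_iUnion_fintype (fun j => hk (measurableSet_singleton j))
    (fun i j hij => Disjoint.preimage k (Set.disjoint_singleton.2 hij)) fun j => hg.integrableOn]
  rw [← Set.preimage_iUnion, Set.iUnion_of_singleton, Set.preimage_univ, setIntegral_univ]

lemma integral_norm_sub_average_sq_le {α : Type*} [MeasurableSpace α] {m : Measure α}
    [IsFiniteMeasure m] {T : α → Euc d} (hT : MemLp T 2 m) (c : Euc d) :
    ∫ x, ‖T x - ⨍ y, T y ∂m‖ ^ 2 ∂m ≤ ∫ x, ‖T x - c‖ ^ 2 ∂m := by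
  set a : Euc d := ⨍ y, T y ∂m with ha
  have hTa : MemLp (fun x => T x - a) 2 m := hT.sub (memLp_const a)
  have hTai : Integrable (fun x => T x - a) m := hTa.integrable one_le_two
  have h0 : ∫ x, ⟪a - c, T x - a⟫ ∂m = 0 := by
    rw [integral_inner hTai, ha, integral_sub_average, inner_zero_right]
  have h1 : Integrable (fun x => ‖T x - a‖ ^ 2) m := hTa.integrable_norm_pow two_ne_zero
  have h2 : Integrable (fun x => 2 * ⟪a - c, T x - a⟫) m := (hTai.const_inner _).const_mul 2
  calc ∫ x, ‖T x - a‖ ^ 2 ∂m = ∫ x, (‖T x - a‖ ^ 2 + 2 * ⟪a - c, T x - a⟫) ∂m := by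
        rw [integral_add h1 h2, integral_const_mul, h0, mul_zero, add_zero]
    _ ≤ ∫ x, ‖T x - c‖ ^ 2 ∂m := by
        refine integral_mono (h1.add h2)
          ((hT.sub (memLp_const c)).integrable_norm_pow two_ne_zero) fun x => ?_
        have h3 : T x - c = (T x - a) + (a - c) := by abel
        have h4 := norm_add_sq_real (T x - a) (a - c)
        rw [real_inner_comm] at h4
        simp only [h3, h4]
        nlinarith [sq_nonneg ‖a - c‖]

lemma memLp_comp_cell {α : Type*} [MeasurableSpace α] {m : Measure α} [IsFiniteMeasure m]
    {k : α → ι} (hk : Measurable k) (b : ι → Euc d) : MemLp (fun x => b (k x)) 2 m := by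
  have hb : Measurable fun x => b (k x) := (measurable_of_countable b).comp hk
  exact MemLp.of_bound hb.aestronglyMeasurable (∑ j, ‖b j‖) (Eventually.of_forall fun x =>
    Finset.single_le_sum (f := fun j => ‖b j‖) (fun _ _ => norm_nonneg _)
      (Finset.mem_univ (k x)))

/-- Averaging over the cells is the best approximation by functions of the cell. -/
lemma integral_norm_sub_cell_average_sq_le {α : Type*} [MeasurableSpace α] {m : Measure α}
    [IsFiniteMeasure m] {T : α → Euc d} (hT : MemLp T 2 m) {k : α → ι} (hk : Measurable k)
    (c : ι → Euc d) :
    ∫ x, ‖T x - ⨍ y in k ⁻¹' {k x}, T y ∂m‖ ^ 2 ∂m ≤ ∫ x, ‖T x - c (k x)‖ ^ 2 ∂m := by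
  have hcell : ∀ b : ι → Euc d, ∫ x, ‖T x - b (k x)‖ ^ 2 ∂m =
      ∑ j, ∫ x in k ⁻¹' {j}, ‖T x - b j‖ ^ 2 ∂m := fun b => by
    have hb : MemLp (fun x => T x - b (k x)) 2 m := hT.sub (memLp_comp_cell hk b)
    rw [integral_eq_sum_preimage hk (hb.integrable_norm_pow two_ne_zero)]
    refine Finset.sum_congr rfl fun j _ => setIntegral_congr_fun
      (hk (measurableSet_singleton j)) fun x hx => ?_
    have hxj : k x = j := hx
    simp only [hxj]
  rw [hcell fun j => ⨍ y in k ⁻¹' {j}, T y ∂m, hcell c]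
  exact Finset.sum_le_sum fun j _ =>
    integral_norm_sub_average_sq_le (hT.mono_measure Measure.restrict_le_self) (c j)

variable {μ ν : ProbabilityMeasure (Euc d)} {k : Euc d → ι} {f : ι → Euc d → ℝ}

/-- The coupling of `μ` and `ν` which is constant on the cells `k ⁻¹' {j}`, on which it
disintegrates as the pieces of `ν` cut out by a partition of unity. -/
lemma IsUnityPartition.exists_coupling (hf : IsUnityPartition f) (hk : Measurable k)
    (hpos : ∀ j, (μ : Measure (Euc d)) (k ⁻¹' {j}) ≠ 0)
    (hmass : ∀ j, ∫ y, f j y ∂(ν : Measure (Euc d)) = (μ : Measure (Euc d)).real (k ⁻¹' {j})) :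
    ∃ π, IsCoupling μ ν π ∧ ∀ᵐ x ∂(μ : Measure (Euc d)), baryMap π x =
      ((μ : Measure (Euc d)).real (k ⁻¹' {k x}))⁻¹ •
        ∫ y, f (k x) y • y ∂(ν : Measure (Euc d)) := by
  set m : ι → ℝ := fun j => (μ : Measure (Euc d)).real (k ⁻¹' {j}) with hm
  have hm0 : ∀ j, 0 < m j := fun j => ENNReal.toReal_pos (hpos j) (measure_ne_top _ _)
  set ρ : ι → Euc d → ℝ≥0∞ := fun j y => ENNReal.ofReal ((m j)⁻¹ * f j y) with hρ
  have hρm : ∀ j, Measurable (ρ j) := fun j => ((hf.measurable j).const_mul _).ennreal_ofReal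
  have hρ0 : ∀ j y, 0 ≤ (m j)⁻¹ * f j y := fun j y =>
    mul_nonneg (inv_pos.2 (hm0 j)).le (hf.nonneg j y)
  have hfi : ∀ j, Integrable (f j) (ν : Measure (Euc d)) := fun j => by
    simpa using hf.integrable_smul j (integrable_const (1 : ℝ))
  have hρ1 : ∀ j, IsProbabilityMeasure ((ν : Measure (Euc d)).withDensity (ρ j)) := fun j => by
    refine ⟨?_⟩
    rw [withDensity_apply _ MeasurableSet.univ, setLIntegral_univ,
      ← ofReal_integral_eq_lintegral_ofReal ((hfi j).const_mul _)
        (Eventually.of_forall (hρ0 j)), integral_const_mul, hmass, inv_mul_cancel₀ (hm0 j).ne',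
      ENNReal.ofReal_one]
  let κ : Kernel (Euc d) (Euc d) :=
    (Kernel.ofFunOfCountable fun j => (ν : Measure (Euc d)).withDensity (ρ j)).comap k hk
  have hκ : ∀ x, κ x = (ν : Measure (Euc d)).withDensity (ρ (k x)) := fun x => rfl
  have : IsMarkovKernel κ := ⟨fun x => hρ1 (k x)⟩
  let π : ProbabilityMeasure (Euc d × Euc d) := ⟨(μ : Measure (Euc d)) ⊗ₘ κ, inferInstance⟩
  have hfst : (π : Measure (Euc d × Euc d)).fst = (μ : Measure (Euc d)) :=
    Measure.fst_compProd _ _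
  refine ⟨π, ⟨hfst, ?_⟩, ?_⟩
  · change ((μ : Measure (Euc d)) ⊗ₘ κ).snd = _
    ext s hs
    rw [Measure.snd_compProd, Measure.bind_apply hs κ.aemeasurable]
    have h1 : ∀ j, ((ν : Measure (Euc d)).withDensity (ρ j)) s *
        (μ : Measure (Euc d)).map k {j} = ∫⁻ y in s, ENNReal.ofReal (f j y) ∂ν := fun j => by
      rw [withDensity_apply _ hs, Measure.map_apply hk (measurableSet_singleton j),
        ← lintegral_mul_const _ (hρm j)]
      refine lintegral_congr fun y => ?_
      rw [← ENNReal.ofReal_toReal (measure_ne_top (μ : Measure (Euc d)) (k ⁻¹' {j})),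
        ← ENNReal.ofReal_mul (hρ0 j y)]
      have : m j ≠ 0 := (hm0 j).ne'
      congr 1
      change (m j)⁻¹ * f j y * m j = f j y
      field_simp
    calc ∫⁻ x, κ x s ∂(μ : Measure (Euc d))
        = ∫⁻ j, ((ν : Measure (Euc d)).withDensity (ρ j)) s ∂((μ : Measure (Euc d)).map k) :=
          (lintegral_map (f := fun j => ((ν : Measure (Euc d)).withDensity (ρ j)) s)
            (measurable_of_countable _) hk).symm
      _ = ∑ j, ∫⁻ y in s, ENNReal.ofReal (f j y) ∂ν := by
          rw [lintegral_fintype, Finset.sum_congr rfl fun j _ => h1 j]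
      _ = ∫⁻ y in s, 1 ∂(ν : Measure (Euc d)) := by
          rw [← lintegral_finsetSum _ fun j _ => (hf.measurable j).ennreal_ofReal]
          refine lintegral_congr fun y => ?_
          rw [← ENNReal.ofReal_sum_of_nonneg fun j _ => hf.nonneg j y, hf.sum_eq_one,
            ENNReal.ofReal_one]
      _ = (ν : Measure (Euc d)) s := setLIntegral_one s
  · have h1 : (π : Measure (Euc d × Euc d)) =
        (π : Measure (Euc d × Euc d)).fst ⊗ₘ κ := by
      rw [hfst]
      rfl
    have h2 := eq_condKernel_of_measure_eq_compProd κ h1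
    rw [hfst] at h2
    filter_upwards [h2] with x hx
    rw [baryMap, ← hx, hκ, bary, integral_withDensity_eq_integral_toReal_smul (hρm _)
      (Eventually.of_forall fun y => ENNReal.ofReal_lt_top), ← integral_smul]
    refine integral_congr_ae (Eventually.of_forall fun y => ?_)
    simp only [hρ, ENNReal.toReal_ofReal (hρ0 _ _), mul_smul]
    rfl

/-- Approximate Strassen theorem: the averages over cells of a map which is dominated by `ν`
are nearly the barycenters of a coupling. -/
lemma exists_coupling_near_cell_average (hν : Mem2 ν) {T : Euc d → Euc d}
    (hT : Integrable T (μ : Measure (Euc d)))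
    (hTν : ∀ φ : Euc d → ℝ, ConvexTest φ →
      ∫ x, φ (T x) ∂(μ : Measure (Euc d)) ≤ ∫ y, φ y ∂(ν : Measure (Euc d)))
    (hk : Measurable k) (hpos : ∀ j, (μ : Measure (Euc d)) (k ⁻¹' {j}) ≠ 0)
    {δ : ℝ} (hδ : 0 < δ) :
    ∃ π, IsCoupling μ ν π ∧ ∀ᵐ x ∂(μ : Measure (Euc d)),
      ‖(⨍ y in k ⁻¹' {k x}, T y ∂(μ : Measure (Euc d))) - baryMap π x‖ ≤ δ := by
  have : Nonempty ι := (inferInstance : Nonempty (Euc d)).map k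
  set m : ι → ℝ := fun j => (μ : Measure (Euc d)).real (k ⁻¹' {j}) with hm
  have hm0 : ∀ j, 0 < m j := fun j => ENNReal.toReal_pos (hpos j) (measure_ne_top _ _)
  set c : ℝ := Finset.univ.inf' Finset.univ_nonempty m with hc
  have hc0 : 0 < c := (Finset.lt_inf'_iff _).2 fun j _ => hm0 j
  have hcm : ∀ j, c ≤ m j := fun j => Finset.inf'_le _ (Finset.mem_univ j)
  have hTone : Integrable (fun x => ((1 : ℝ), T x)) (μ : Measure (Euc d)) :=
    (integrable_const _).prodMk hT
  set w : ι → ℝ × Euc d := fun j => (m j, ∫ x in k ⁻¹' {j}, T x ∂(μ : Measure (Euc d))) with hw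
  have hwint : ∀ j, w j = ∫ x in k ⁻¹' {j}, ((1 : ℝ), T x) ∂(μ : Measure (Euc d)) := fun j => by
    rw [integral_pair (integrable_const _) hT.integrableOn]
    simp [hw, hm]
  have hdom : ∀ L : ι → ℝ × Euc d →L[ℝ] ℝ,
      ∑ j, L j (w j) ≤ ∫ y, affineMax L y ∂(ν : Measure (Euc d)) := fun L => by
    have hL := convexTest_affineMax L
    refine le_trans ?_ (hTν _ hL)
    rw [integral_eq_sum_preimage hk (hL.integrable_comp hT)]
    refine Finset.sum_le_sum fun j _ => ?_
    rw [hwint, ← ContinuousLinearMap.integral_comp_comm _ hTone.integrableOn]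
    exact integral_mono ((L j).integrable_comp hTone.integrableOn)
      (hL.integrable_comp hT).integrableOn fun x => le_affineMax L j (T x)
  have hsum : ∑ j, (w j).1 = 1 := by
    have h := integral_eq_sum_preimage hk (integrable_const (1 : ℝ) (μ := (μ : Measure (Euc d))))
    simpa [hw, hm, measureReal_def] using h.symm
  obtain ⟨f, hf, hmass, hnear⟩ := exists_isUnityPartition_moments
    (hν.memLp.integrable one_le_two) hm0 hsum hdom (mul_pos hδ hc0)
  obtain ⟨π, hπ, hbary⟩ := hf.exists_coupling hk hpos hmass
  refine ⟨π, hπ, ?_⟩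
  filter_upwards [hbary] with x hx
  rw [hx, setAverage_eq, ← smul_sub, norm_smul, norm_inv, Real.norm_of_nonneg measureReal_nonneg,
    norm_sub_rev, inv_mul_le_iff₀ (hm0 (k x))]
  refine (hnear (k x)).le.trans ?_
  rw [mul_comm (m (k x))]
  exact mul_le_mul_of_nonneg_left (hcm (k x)) hδ.le

end Cells

/-- Square integrable maps are approximated by functions of finitely many non-null cells. -/
lemma exists_cells_approx {α : Type*} [MeasurableSpace α] {m : Measure α} [NeZero m]
    {T : α → Euc d} (hT : MemLp T 2 m) {δ : ℝ≥0∞} (hδ : δ ≠ 0) :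
    ∃ (s : Finset (Euc d)) (k : α → s), Measurable k ∧ (∀ j, m (k ⁻¹' {j}) ≠ 0) ∧
      eLpNorm (fun x => T x - k x) 2 m < δ := by
  classical
  obtain ⟨g, hg, -⟩ := hT.exists_simpleFunc_eLpNorm_sub_lt (by simp) hδ
  have hnull : m {x | m (g ⁻¹' {g x}) = 0} = 0 := by
    refine measure_mono_null (t := ⋃ c ∈ g.range.filter fun c => m (g ⁻¹' {c}) = 0, g ⁻¹' {c})
      (fun x hx => ?_) ((measure_biUnion_null_iff (Finset.countable_toSet _)).2 fun c hc =>
        (Finset.mem_filter.1 hc).2)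
    simp only [Set.mem_iUnion]
    exact ⟨g x, Finset.mem_filter.2 ⟨g.mem_range_self x, hx⟩, rfl⟩
  have hae : ∀ᵐ x ∂m, m (g ⁻¹' {g x}) ≠ 0 := by
    simpa only [ae_iff, not_not] using hnull
  obtain ⟨x₀, hx₀⟩ := hae.exists
  set h : Euc d → Euc d := fun c => if m (g ⁻¹' {c}) ≠ 0 then c else g x₀ with hh
  have hpos : ∀ c, m (g ⁻¹' {h c}) ≠ 0 := fun c => by
    simp only [hh]
    split_ifs with hc
    exacts [hc, hx₀]
  have hfix : ∀ c, h (h c) = h c := fun c => if_pos (hpos c)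
  refine ⟨(g.map h).range, fun x => ⟨g.map h x, SimpleFunc.mem_range_self _ x⟩,
    (g.map h).measurable.subtype_mk, fun ⟨c, hc⟩ h0 => ?_, ?_⟩
  · obtain ⟨x, rfl⟩ := SimpleFunc.mem_range.1 hc
    refine hpos (g x) (measure_mono_null (fun y hy => ?_) h0)
    have hy' : g y = h (g x) := hy
    refine Subtype.ext ?_
    change h (g y) = h (g x)
    rw [hy', hfix]
  · refine lt_of_eq_of_lt (eLpNorm_congr_ae ?_) hg
    filter_upwards [hae] with x hx
    have : h (g x) = g x := if_pos hx
    change T x - h (g x) = T x - g x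
    rw [this]

lemma lintegral_ofReal_norm_sq_eq_eLpNorm {α : Type*} [MeasurableSpace α] {m : Measure α}
    (f : α → Euc d) : ∫⁻ x, ENNReal.ofReal (‖f x‖ ^ 2) ∂m = eLpNorm f 2 m ^ 2 := by
  have h := eLpNorm_nnreal_pow_eq_lintegral (f := f) (μ := m) (p := 2) two_ne_zero
  simp only [ENNReal.coe_ofNat, NNReal.coe_ofNat, ENNReal.rpow_ofNat] at h
  rw [h]
  refine lintegral_congr fun x => ?_
  rw [ENNReal.ofReal_pow (norm_nonneg _), ofReal_norm]

/-- The weak transport value is at most the cost of any map dominated by `ν`. -/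
lemma weakVal2_le {μ ν : ProbabilityMeasure (Euc d)} (hμ : Mem2 μ) (hν : Mem2 ν)
    {T : Euc d → Euc d} (hT : MemLp T 2 (μ : Measure (Euc d)))
    (hTν : ∀ φ : Euc d → ℝ, ConvexTest φ →
      ∫ x, φ (T x) ∂(μ : Measure (Euc d)) ≤ ∫ y, φ y ∂(ν : Measure (Euc d))) :
    weakVal2 μ ν ≤ ∫⁻ x, ENNReal.ofReal (‖x - T x‖ ^ 2) ∂(μ : Measure (Euc d)) := by
  have hidT : MemLp (fun x => x - T x) 2 (μ : Measure (Euc d)) := hμ.memLp.sub hT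
  have hmain : ∀ δ : ℝ≥0, 0 < δ → weakVal2 μ ν ≤
      (eLpNorm (fun x => x - T x) 2 (μ : Measure (Euc d)) + (δ + δ)) ^ 2 := fun δ hδ => by
    have hne := IsProbabilityMeasure.ne_zero (μ : Measure (Euc d))
    have : NeZero (μ : Measure (Euc d)) := ⟨hne⟩
    obtain ⟨s, k, hk, hpos, hks⟩ := exists_cells_approx hT (ENNReal.coe_ne_zero.2 hδ.ne')
    obtain ⟨π, hπ, hnear⟩ := exists_coupling_near_cell_average hν (hT.integrable one_le_two) hTν
      hk hpos (NNReal.coe_pos.2 hδ)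
    set t : s → Euc d := fun j => ⨍ y in k ⁻¹' {j}, T y ∂(μ : Measure (Euc d)) with ht
    have hTt : MemLp (fun x => T x - t (k x)) 2 (μ : Measure (Euc d)) := hT.sub (memLp_comp_cell hk t)
    have hTk : MemLp (fun x => T x - k x) 2 (μ : Measure (Euc d)) :=
      hT.sub (memLp_comp_cell hk fun j => (j : Euc d))
    have htπ : MemLp (fun x => t (k x) - baryMap π x) 2 (μ : Measure (Euc d)) :=
      (memLp_comp_cell hk t).sub (hπ.memLp_baryMap hν)
    have h1 : eLpNorm (fun x => T x - t (k x)) 2 (μ : Measure (Euc d)) ≤ δ := by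
      refine le_trans ?_ hks.le
      rw [← ENNReal.pow_le_pow_left_iff two_ne_zero, ← lintegral_ofReal_norm_sq_eq_eLpNorm,
        ← lintegral_ofReal_norm_sq_eq_eLpNorm, lintegral_ofReal_norm_sq hTt,
        lintegral_ofReal_norm_sq hTk]
      exact ENNReal.ofReal_le_ofReal
        (integral_norm_sub_cell_average_sq_le hT hk fun j => (j : Euc d))
    have h2 : eLpNorm (fun x => t (k x) - baryMap π x) 2 (μ : Measure (Euc d)) ≤ δ := by
      refine (eLpNorm_le_of_ae_bound hnear).trans_eq ?_
      simp
    have h3 : eLpNorm (fun x => x - baryMap π x) 2 (μ : Measure (Euc d)) ≤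
        eLpNorm (fun x => x - T x) 2 (μ : Measure (Euc d)) + (δ + δ) := by
      have h4 : (fun x => x - baryMap π x) =
          (fun x => x - T x) + ((fun x => T x - t (k x)) + fun x => t (k x) - baryMap π x) := by
        ext1 x
        simp
      rw [h4]
      refine (eLpNorm_add_le hidT.1 (hTt.1.add htπ.1) one_le_two).trans ?_
      gcongr
      exact (eLpNorm_add_le hTt.1 htπ.1 one_le_two).trans (add_le_add h1 h2)
    calc weakVal2 μ ν ≤ weakCost2 μ π := iInf₂_le π hπ
      _ = eLpNorm (fun x => x - baryMap π x) 2 (μ : Measure (Euc d)) ^ 2 :=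
        lintegral_ofReal_norm_sq_eq_eLpNorm _
      _ ≤ _ := by gcongr
  rw [lintegral_ofReal_norm_sq_eq_eLpNorm]
  have hlim : Tendsto (fun δ : ℝ≥0 =>
      (eLpNorm (fun x => x - T x) 2 (μ : Measure (Euc d)) + ((δ : ℝ≥0∞) + δ)) ^ 2) (𝓝[>] 0)
      (𝓝 (eLpNorm (fun x => x - T x) 2 (μ : Measure (Euc d)) ^ 2)) := by
    have hcont : Continuous fun δ : ℝ≥0 =>
        (eLpNorm (fun x => x - T x) 2 (μ : Measure (Euc d)) + ((δ : ℝ≥0∞) + δ)) ^ 2 := by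
      fun_prop
    simpa using (hcont.tendsto 0).mono_left nhdsWithin_le_nhds
  exact ge_of_tendsto hlim (eventually_nhdsWithin_of_forall hmain)

lemma IsBaryProjection.weakVal2_eq {μ ν : ProbabilityMeasure (Euc d)} {T : Euc d → Euc d}
    (hT : IsBaryProjection μ ν T) (hμ : Mem2 μ) (hν : Mem2 ν) :
    weakVal2 μ ν = ∫⁻ x, ENNReal.ofReal (‖x - T x‖ ^ 2) ∂(μ : Measure (Euc d)) := by
  refine le_antisymm (weakVal2_le hμ hν hT.memLp hT.integral_comp_le) (le_iInf₂ fun π h => ?_)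
  refine le_trans ?_ (hT.le_weakCost2 hμ hν h)
  rw [lintegral_ofReal_norm_sq (hT.memLp_id_sub hμ)]
  exact ENNReal.ofReal_le_ofReal (le_add_of_nonneg_right (integral_nonneg fun x => by positivity))

end BarycentricProjection

/-- The Brenier–Strassen theorem of Gozlan and Juillet. -/
theorem brenier_strassen
    (μ ν η : ProbabilityMeasure (Euc d))
    (hμ : Mem2 μ) (hν : Mem2 ν) (hη : Mem2 η) (hord : ConvexOrder η ν) :
    W2sq μ η = V2sq μ ν ↔
      ∃ φ : Euc d → ℝ,
        ConvexOn ℝ Set.univ φ ∧ Differentiable ℝ φ ∧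
        LipschitzWith 1 (gradient φ) ∧
        (η : Measure (Euc d)) = (μ : Measure (Euc d)).map (gradient φ) ∧
        weakVal2 μ ν =
          ∫⁻ x, ENNReal.ofReal (‖x - gradient φ x‖ ^ 2) ∂(μ : Measure (Euc d)) ∧
        ∀ π : ProbabilityMeasure (Euc d × Euc d),
          IsCoupling μ ν π → weakCost2 μ π = weakVal2 μ ν →
            (μ : Measure (Euc d)).map
                (fun x => (x, bary ((π : Measure (Euc d × Euc d)).condKernel x))) =
              (μ : Measure (Euc d)).map (fun x => (x, gradient φ x)) := by
  obtain ⟨T, hT⟩ := exists_isBaryProjection hμ hν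
  have hV := hT.V2sq_eq hμ
  have hW := hT.weakVal2_eq hμ hν
  constructor
  · intro h
    obtain ⟨φ, hconv, hdiff, hlip, hφT⟩ := hT.exists_gradient hμ
    refine ⟨φ, hconv, hdiff, hlip, ?_, ?_, fun π hπ hopt => ?_⟩
    · rw [hT.eq_map_of_W2sq_le hμ hη hord (h.trans hV).le]
      exact Measure.map_congr hφT.symm
    · rw [hW]
      refine lintegral_congr_ae ?_
      filter_upwards [hφT] with x hx
      rw [hx]
    · refine Measure.map_congr ?_
      filter_upwards [hφT, hT.baryMap_ae_eq hμ hν hπ (hopt.trans hW).le] with x hx hπx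
      rw [hx, ← hπx, baryMap]
  · rintro ⟨φ, -, -, hlip, hηφ, hval, -⟩
    refine le_antisymm ?_ (iInf₂_le η hord)
    rw [hV, ← hW, hval]
    exact IsBaryProjection.W2sq_map_le hlip.continuous.measurable hηφ

end
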